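/- arXiv:1704.08358 — 3 statements merged into one kernel-verified Lean document; each statement's English description precedes it below -/
import Mathlib

section
/- Let p be an odd prime, k a positive integer, and r an integer coprime to p. Then x_k(r;p) = (1/2)(2/π)^k · Σ_{n∈ℤ, n≠0, n≡r mod p} d_k(|n|)/n, where the sum is interpreted as the limit as X→∞ of the truncation at |n|≤X, d_k is the k-fold divisor function, and x_k(r;p) := p^{-k} Σ* cot(π m_1/p)···cot(π m_k/p) over tuples (m_1,...,m_k) of residues coprime to p with m_1···m_k ≡ r mod p. -/
open scoped Real

noncomputable def xk (k p : ℕ) [NeZero p] (r : ZMod p) : ℝ :=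
  ((p : ℝ))⁻¹ ^ k *
    ∑ m ∈ Finset.univ.filter (fun m : Fin k → (ZMod p)ˣ => ∏ i, ((m i : ZMod p)) = r),
      ∏ i, Real.cot (π * ((m i : ZMod p).val : ℝ) / p)

/-- The `k`-fold divisor function. -/
def dk (k n : ℕ) : ℕ :=
  ((Fintype.piFinset fun _ : Fin k => Finset.range (n + 1)).filter
    (fun f => ∏ i, f i = n)).card

open Finset

lemma sum_Ioc_restrict (F : ℕ → ℝ) {a N : ℕ} (h : a ≤ N) :
    ∑ n ∈ Ioc 0 a, F n = ∑ n ∈ Ioc 0 N, if n ≤ a then F n else 0 := by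
  rw [← sum_filter]
  congr 1
  ext x
  simp only [mem_Ioc, mem_filter]
  omega

lemma hyperbola (f g : ArithmeticFunction ℝ) (N : ℕ) :
    ∑ n ∈ Ioc 0 N, (f * g) n =
      ∑ m ∈ Ioc 0 N.sqrt, f m * ∑ n ∈ Ioc 0 (N / m), g n
      + ∑ n ∈ Ioc 0 N.sqrt, g n * ∑ m ∈ Ioc 0 (N / n), f m
      - (∑ m ∈ Ioc 0 N.sqrt, f m) * (∑ n ∈ Ioc 0 N.sqrt, g n) := by
  have hy : N.sqrt ≤ N := Nat.sqrt_le_self N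
  have key : ∀ (a b : ArithmeticFunction ℝ), ∑ m ∈ Ioc 0 N.sqrt, a m * ∑ n ∈ Ioc 0 (N / m), b n =
      ∑ m ∈ Ioc 0 N, ∑ n ∈ Ioc 0 N, if m ≤ N.sqrt ∧ m * n ≤ N then a m * b n else 0 := by
    intro a b
    rw [sum_Ioc_restrict _ hy]
    refine sum_congr rfl fun m hm => ?_
    rw [mem_Ioc] at hm
    split_ifs with h
    · rw [sum_Ioc_restrict _ (Nat.div_le_self N m), mul_sum]
      refine sum_congr rfl fun n _ => ?_
      simp only [Nat.le_div_iff_mul_le hm.1, mul_comm n m]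
      split_ifs <;> simp_all
    · simp [h]
  rw [key, key, ArithmeticFunction.sum_Ioc_mul_eq_sum_prod_filter, sum_filter, sum_product,
    sum_Ioc_restrict (fun m => f m) hy, sum_Ioc_restrict (fun m => g m) hy, sum_mul_sum,
    sum_comm (γ := ℕ) (f := fun m n => if m ≤ N.sqrt ∧ m * n ≤ N then g m * f n else 0),
    ← sum_add_distrib, ← sum_sub_distrib]
  refine sum_congr rfl fun m hm => ?_
  rw [← sum_add_distrib, ← sum_sub_distrib]
  refine sum_congr rfl fun n hn => ?_
  have h1 : N < (N.sqrt + 1) * (N.sqrt + 1) := Nat.lt_succ_sqrt N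
  have h2 : N.sqrt * N.sqrt ≤ N := Nat.sqrt_le N
  rw [mul_comm n m]
  by_cases hm' : m ≤ N.sqrt <;> by_cases hn' : n ≤ N.sqrt
  · have : m * n ≤ N := (Nat.mul_le_mul hm' hn').trans h2
    simp [hm', hn', this, mul_comm]
  · simp [hm', hn']
  · simp [hm', hn', mul_comm]
  · have : ¬ m * n ≤ N := by
      push Not at *
      exact h1.trans_le (Nat.mul_le_mul hm' hn')
    simp [hm', hn', this]

noncomputable def ell (N : ℕ) : ℝ := 1 + Real.log N

lemma ell_one_le {N : ℕ} : 1 ≤ ell N := by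
  unfold ell
  have : 0 ≤ Real.log N := Real.log_natCast_nonneg N
  linarith

lemma ell_mono {M N : ℕ} (hM : 1 ≤ M) (h : M ≤ N) : ell M ≤ ell N := by
  unfold ell
  have : Real.log M ≤ Real.log N :=
    Real.log_le_log (by exact_mod_cast hM) (by exact_mod_cast h)
  linarith

lemma ell_sqrt {N : ℕ} (hN : 1 ≤ N) : ell N ≤ 3 * ell N.sqrt := by
  unfold ell
  have h1 : N < (N.sqrt + 1) * (N.sqrt + 1) := Nat.lt_succ_sqrt N
  have hy : 1 ≤ N.sqrt := Nat.sqrt_pos.mpr hN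
  have h2 : N ≤ 4 * N.sqrt ^ 2 := by nlinarith
  have h3 : Real.log N ≤ Real.log (4 * (N.sqrt : ℝ) ^ 2) :=
    Real.log_le_log (by exact_mod_cast hN) (by exact_mod_cast h2)
  have hy' : (0 : ℝ) < N.sqrt := by exact_mod_cast hy
  rw [Real.log_mul (by norm_num) (by positivity), Real.log_pow] at h3
  have h4 : Real.log 4 ≤ 2 := by
    have : Real.log 4 = 2 * Real.log 2 := by
      rw [show (4 : ℝ) = 2 ^ 2 by norm_num, Real.log_pow]; norm_num
    have := Real.log_two_lt_d9
    linarith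
  have : 0 ≤ Real.log N.sqrt := Real.log_natCast_nonneg _
  push_cast at h3
  linarith

/-- Partial sums converge to `A` faster than every power of log. -/
def FastConv (f : ArithmeticFunction ℝ) (A : ℝ) : Prop :=
  ∀ j : ℕ, ∃ C : ℝ, ∀ N : ℕ, 1 ≤ N → |∑ n ∈ Ioc 0 N, f n - A| * ell N ^ j ≤ C

/-- Absolute partial sums grow at most like a power of log. -/
def LogBdd (f : ArithmeticFunction ℝ) : Prop :=
  ∃ (C : ℝ) (j : ℕ), ∀ N : ℕ, 1 ≤ N → ∑ n ∈ Ioc 0 N, |f n| ≤ C * ell N ^ j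

lemma FastConv.add {f g : ArithmeticFunction ℝ} {A B : ℝ} (hf : FastConv f A) (hg : FastConv g B) :
    FastConv (f + g) (A + B) := by
  intro j
  obtain ⟨C, hC⟩ := hf j
  obtain ⟨D, hD⟩ := hg j
  refine ⟨C + D, fun N hN => ?_⟩
  have h0 : 0 ≤ ell N ^ j := pow_nonneg (zero_le_one.trans ell_one_le) _
  have : ∑ n ∈ Ioc 0 N, (f + g) n - (A + B) =
    (∑ n ∈ Ioc 0 N, f n - A) + (∑ n ∈ Ioc 0 N, g n - B) := by
    simp only [ArithmeticFunction.add_apply, sum_add_distrib]; ring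
  rw [this]
  calc _ ≤ (|∑ n ∈ Ioc 0 N, f n - A| + |∑ n ∈ Ioc 0 N, g n - B|) * ell N ^ j :=
        mul_le_mul_of_nonneg_right (abs_add_le _ _) h0
    _ ≤ _ := by rw [add_mul]; exact add_le_add (hC N hN) (hD N hN)

lemma FastConv.zero : FastConv 0 0 := fun j => ⟨0, fun N _ => by simp⟩

lemma FastConv.sum {ι : Type*} (s : Finset ι) {f : ι → ArithmeticFunction ℝ} {A : ι → ℝ}
    (h : ∀ i ∈ s, FastConv (f i) (A i)) : FastConv (∑ i ∈ s, f i) (∑ i ∈ s, A i) := by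
  classical
  induction s using Finset.induction_on with
  | empty => simpa using FastConv.zero
  | insert a s ha ih =>
    rw [sum_insert ha, sum_insert ha]
    exact (h a (by simp)).add (ih fun i hi => h i (by simp [hi]))

lemma FastConv.mul_aux {f g : ArithmeticFunction ℝ} {B : ℝ} (hf : LogBdd f) (hg : FastConv g B)
    (j : ℕ) : ∃ C : ℝ, ∀ N : ℕ, 1 ≤ N →
      |∑ m ∈ Ioc 0 N.sqrt, f m * (∑ n ∈ Ioc 0 (N / m), g n - B)| * ell N.sqrt ^ j ≤ C := by
  obtain ⟨C, i, hC⟩ := hf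
  obtain ⟨D, hD⟩ := hg (i + j)
  refine ⟨C * D, fun N hN => ?_⟩
  have hy : 1 ≤ N.sqrt := Nat.sqrt_pos.mpr hN
  set y := N.sqrt with hydef
  have h0 : 0 < ell y := zero_lt_one.trans_le ell_one_le
  have hD0 : 0 ≤ D := (mul_nonneg (abs_nonneg _) (pow_nonneg (zero_le_one.trans ell_one_le) _)).trans
    (hD 1 le_rfl)
  have h1 : |∑ m ∈ Ioc 0 y, f m * (∑ n ∈ Ioc 0 (N / m), g n - B)| * ell y ^ (i + j) ≤
      (∑ m ∈ Ioc 0 y, |f m|) * D := by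
    calc _ ≤ (∑ m ∈ Ioc 0 y, |f m * (∑ n ∈ Ioc 0 (N / m), g n - B)|) * ell y ^ (i + j) :=
          mul_le_mul_of_nonneg_right (abs_sum_le_sum_abs _ _) (by positivity)
      _ ≤ _ := by
          rw [sum_mul, sum_mul]
          refine sum_le_sum fun m hm => ?_
          rw [mem_Ioc] at hm
          rw [abs_mul, mul_assoc]
          refine mul_le_mul_of_nonneg_left ?_ (abs_nonneg _)
          have hyN : y ≤ N / m := by
            rw [Nat.le_div_iff_mul_le hm.1]
            exact (Nat.mul_le_mul_left y hm.2).trans (Nat.sqrt_le N)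
          refine le_trans ?_ (hD (N / m) (hy.trans hyN))
          gcongr
          exact ell_mono hy hyN
  have h2 : (∑ m ∈ Ioc 0 y, |f m|) * D ≤ C * ell y ^ i * D :=
    mul_le_mul_of_nonneg_right (hC y hy) hD0
  have h3 := h1.trans h2
  rw [pow_add] at h3
  have hp : 0 < ell y ^ i := by positivity
  refine le_of_mul_le_mul_right ?_ hp
  linarith

lemma FastConv.mul {f g : ArithmeticFunction ℝ} {A B : ℝ} (hf : FastConv f A) (hg : FastConv g B)
    (hf' : LogBdd f) (hg' : LogBdd g) : FastConv (f * g) (A * B) := by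
  intro j
  obtain ⟨C₁, h₁⟩ := FastConv.mul_aux hf' hg j
  obtain ⟨C₂, h₂⟩ := FastConv.mul_aux hg' hf j
  obtain ⟨C₃, h₃⟩ := hf j
  obtain ⟨C₄, h₄⟩ := hg 0
  refine ⟨3 ^ j * (C₁ + C₂ + C₃ * C₄), fun N hN => ?_⟩
  have hy : 1 ≤ N.sqrt := Nat.sqrt_pos.mpr hN
  specialize h₁ N hN
  specialize h₂ N hN
  specialize h₃ _ hy
  specialize h₄ _ hy
  have hell := ell_sqrt hN
  have h0 : 0 < ell N.sqrt := zero_lt_one.trans_le ell_one_le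
  have h0' : 0 < ell N := zero_lt_one.trans_le ell_one_le
  rw [hyperbola]
  set y := N.sqrt with hydef
  have e : ∑ m ∈ Ioc 0 y, f m * ∑ n ∈ Ioc 0 (N / m), g n
      + ∑ n ∈ Ioc 0 y, g n * ∑ m ∈ Ioc 0 (N / n), f m
      - (∑ m ∈ Ioc 0 y, f m) * (∑ n ∈ Ioc 0 y, g n) - A * B =
      ∑ m ∈ Ioc 0 y, f m * (∑ n ∈ Ioc 0 (N / m), g n - B)
      + ∑ n ∈ Ioc 0 y, g n * (∑ m ∈ Ioc 0 (N / n), f m - A)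
      - (∑ m ∈ Ioc 0 y, f m - A) * (∑ n ∈ Ioc 0 y, g n - B) := by
    simp only [mul_sub, sum_sub_distrib, ← sum_mul]
    ring
  rw [e]
  rw [pow_zero, mul_one] at h₄
  generalize ∑ m ∈ Ioc 0 y, f m * (∑ n ∈ Ioc 0 (N / m), g n - B) = a at *
  generalize ∑ n ∈ Ioc 0 y, g n * (∑ m ∈ Ioc 0 (N / n), f m - A) = b at *
  generalize (∑ m ∈ Ioc 0 y, f m - A) = c at *
  generalize (∑ n ∈ Ioc 0 y, g n - B) = d at *
  have hp : 0 < ell y ^ j := by positivity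
  have habs : |a + b - c * d| ≤ |a| + |b| + |c| * |d| := by
    rw [← abs_mul]
    exact (abs_sub _ _).trans (by gcongr; exact abs_add_le _ _)
  calc |a + b - c * d| * ell N ^ j ≤ (|a| + |b| + |c| * |d|) * (3 * ell y) ^ j := by gcongr
    _ = 3 ^ j * (|a| * ell y ^ j + |b| * ell y ^ j + (|c| * ell y ^ j) * |d|) := by
        rw [mul_pow]; ring
    _ ≤ _ := by
        have : (|c| * ell y ^ j) * |d| ≤ C₃ * C₄ :=
          mul_le_mul h₃ h₄ (abs_nonneg _) ((by positivity : 0 ≤ |c| * ell y ^ j).trans h₃)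
        gcongr

lemma FastConv.smul {f : ArithmeticFunction ℝ} {A : ℝ} (c : ℝ) (hf : FastConv f A) (f' : ArithmeticFunction ℝ)
    (h : ∀ n, f' n = c * f n) : FastConv f' (c * A) := by
  intro j
  obtain ⟨C, hC⟩ := hf j
  refine ⟨|c| * C, fun N hN => ?_⟩
  simp only [h, ← mul_sum, ← mul_sub, abs_mul, mul_assoc]
  exact mul_le_mul_of_nonneg_left (hC N hN) (abs_nonneg _)

lemma LogBdd.mono {f g : ArithmeticFunction ℝ} (hg : LogBdd g) (h : ∀ n, |f n| ≤ |g n|) :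
    LogBdd f := by
  obtain ⟨C, i, hC⟩ := hg
  exact ⟨C, i, fun N hN => (sum_le_sum fun n _ => h n).trans (hC N hN)⟩

lemma LogBdd.mul {f g : ArithmeticFunction ℝ} (hf : LogBdd f) (hg : LogBdd g) :
    LogBdd (f * g) := by
  obtain ⟨C, i, hC⟩ := hf
  obtain ⟨D, j, hD⟩ := hg
  refine ⟨C * D, i + j, fun N hN => ?_⟩
  let f' : ArithmeticFunction ℝ := ⟨fun n => |f n|, by simp⟩
  let g' : ArithmeticFunction ℝ := ⟨fun n => |g n|, by simp⟩
  have h1 : ∑ n ∈ Ioc 0 N, |(f * g) n| ≤ ∑ n ∈ Ioc 0 N, (f' * g') n := by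
    refine sum_le_sum fun n _ => ?_
    rw [ArithmeticFunction.mul_apply, ArithmeticFunction.mul_apply]
    refine (abs_sum_le_sum_abs _ _).trans (le_of_eq (sum_congr rfl fun x _ => abs_mul _ _))
  have h2 : ∑ n ∈ Ioc 0 N, (f' * g') n ≤ (∑ n ∈ Ioc 0 N, |f n|) * (∑ n ∈ Ioc 0 N, |g n|) := by
    rw [ArithmeticFunction.sum_Ioc_mul_eq_sum_prod_filter, sum_mul_sum, ← sum_product']
    refine sum_le_sum_of_subset_of_nonneg (filter_subset _ _) fun x _ _ => ?_
    exact mul_nonneg (abs_nonneg _) (abs_nonneg _)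
  refine h1.trans (h2.trans ?_)
  calc _ ≤ (C * ell N ^ i) * (D * ell N ^ j) :=
        mul_le_mul (hC N hN) (hD N hN) (sum_nonneg fun _ _ => abs_nonneg _)
          ((sum_nonneg fun _ _ => abs_nonneg _).trans (hC N hN))
    _ = _ := by rw [pow_add]; ring

lemma FastConv.tendsto {f : ArithmeticFunction ℝ} {A : ℝ} (hf : FastConv f A) :
    Filter.Tendsto (fun N => ∑ n ∈ Ioc 0 N, f n) Filter.atTop (nhds A) := by
  obtain ⟨C, hC⟩ := hf 1
  rw [tendsto_iff_norm_sub_tendsto_zero]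
  have hl : Filter.Tendsto (fun N : ℕ => C / ell N) Filter.atTop (nhds 0) := by
    apply Filter.Tendsto.const_div_atTop
    exact Filter.tendsto_atTop_add_const_left _ _
      (Real.tendsto_log_atTop.comp tendsto_natCast_atTop_atTop)
  refine squeeze_zero' (Filter.Eventually.of_forall fun _ => norm_nonneg _) ?_ hl
  filter_upwards [Filter.eventually_ge_atTop 1] with N hN
  have h := hC N hN
  rw [pow_one] at h
  rw [Real.norm_eq_abs, le_div_iff₀ (zero_lt_one.trans_le ell_one_le)]
  exact h

/-- one over N decays faster than powers of log -/
lemma ell_pow_le (j : ℕ) : ∃ C : ℝ, ∀ N : ℕ, 1 ≤ N → ell N ^ j ≤ C * N := by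
  refine ⟨(j.factorial : ℝ) * Real.exp 1, fun N hN => ?_⟩
  have h := Real.pow_div_factorial_le_exp (ell N) (zero_le_one.trans ell_one_le) j
  unfold ell at *
  rw [Real.exp_add, Real.exp_log (by exact_mod_cast hN), div_le_iff₀ (by positivity)] at h
  linarith

lemma sum_inv_le (N : ℕ) (hN : 1 ≤ N) : ∑ n ∈ Ioc 0 N, (1 : ℝ) / n ≤ ell N := by
  have h := harmonic_le_one_add_log N
  rw [harmonic_eq_sum_Icc] at h
  push_cast at h
  unfold ell
  have e : Icc 1 N = Ioc 0 N := by ext x; simp only [mem_Icc, mem_Ioc]; omega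
  rw [e] at h
  simpa using h

lemma abel_tail (g : ℕ → ℝ) (B : ℝ) (hB : ∀ N, |∑ n ∈ Ioc 0 N, g n| ≤ B) (M k : ℕ) :
    |∑ n ∈ Ioc 0 (M + k), g n / n - ∑ n ∈ Ioc 0 M, g n / n| ≤ 2 * B / (M + 1) := by
  have key : ∀ k : ℕ, |∑ n ∈ Ioc 0 (M + k), g n / n - ∑ n ∈ Ioc 0 M, g n / n
      - (∑ n ∈ Ioc 0 (M + k), g n) / (M + k + 1) + (∑ n ∈ Ioc 0 M, g n) / (M + 1)|
      ≤ B * (1 / (M + 1) - 1 / (M + k + 1)) := by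
    intro k
    induction k with
    | zero => simp
    | succ k ih =>
      rw [← add_assoc, sum_Ioc_succ_top (by omega), sum_Ioc_succ_top (by omega)]
      have h1 := hB (M + k)
      have h2 := hB (M + k + 1)
      rw [sum_Ioc_succ_top (by omega)] at h2
      set S := ∑ n ∈ Ioc 0 (M + k), g n / n
      set G := ∑ n ∈ Ioc 0 (M + k), g n
      set c := g (M + k + 1)
      push_cast
      have e : S + c / (M + k + 1) - ∑ n ∈ Ioc 0 M, g n / n - (G + c) / (M + (k + 1) + 1)
          + (∑ n ∈ Ioc 0 M, g n) / (M + 1) =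
          (S - ∑ n ∈ Ioc 0 M, g n / n - G / (M + k + 1) + (∑ n ∈ Ioc 0 M, g n) / (M + 1))
          + (G + c) * (1 / (M + k + 1) - 1 / (M + (k + 1) + 1)) := by ring
      rw [e]
      have hpos : (0 : ℝ) ≤ 1 / (M + k + 1) - 1 / (M + (k + 1) + 1) := by
        rw [sub_nonneg]
        apply one_div_le_one_div_of_le <;> [positivity; linarith]
      calc _ ≤ _ := abs_add_le _ _
        _ ≤ B * (1 / (M + 1) - 1 / (M + k + 1)) + B * (1 / (M + k + 1) - 1 / (M + (k + 1) + 1)) := by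
          refine add_le_add ih ?_
          rw [abs_mul, abs_of_nonneg hpos]
          exact mul_le_mul_of_nonneg_right h2 hpos
        _ = _ := by ring
  have h := key k
  have h1 := hB (M + k)
  have h2 := hB M
  have p1 : (0 : ℝ) < M + 1 := by positivity
  have p2 : (0 : ℝ) < M + k + 1 := by positivity
  have h3 : |(∑ n ∈ Ioc 0 (M + k), g n) / (M + k + 1 : ℝ)| ≤ B * (1 / (M + k + 1)) := by
    rw [abs_div, abs_of_pos p2, div_eq_mul_one_div]; gcongr
  have h4 : |(∑ n ∈ Ioc 0 M, g n) / (M + 1 : ℝ)| ≤ B * (1 / (M + 1)) := by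
    rw [abs_div, abs_of_pos p1, div_eq_mul_one_div]; gcongr
  have e : 2 * B / (M + 1) = B * (1 / (M + 1) - 1 / (M + k + 1)) + B * (1 / (M + k + 1 : ℝ))
    + B * (1 / (M + 1)) := by ring
  rw [e]
  rw [abs_le] at *
  constructor <;> linarith [h.1, h.2, h3.1, h3.2, h4.1, h4.2]

/-- odd indicator -/
noncomputable def gg {p : ℕ} (r : (ZMod p)ˣ) (x : ZMod p) : ℝ :=
  (if x = (r : ZMod p) then 1 else 0) - (if x = -(r : ZMod p) then 1 else 0)

lemma abs_gg_le {p : ℕ} (r : (ZMod p)ˣ) (x : ZMod p) : |gg r x| ≤ 1 := by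
  unfold gg
  split_ifs <;> norm_num

lemma sum_range_zmod (p : ℕ) [NeZero p] (F : ZMod p → ℝ) :
    ∑ i ∈ range p, F (i : ZMod p) = ∑ x : ZMod p, F x := by
  refine sum_nbij' (fun i => (i : ZMod p)) (fun x => x.val) ?_ ?_ ?_ ?_ ?_
  · simp
  · intro x _; simpa using ZMod.val_lt x
  · intro i hi; exact ZMod.val_cast_of_lt (by simpa using hi)
  · intro x _; simp
  · simp

lemma sum_Ioc_eq_range (F : ℕ → ℝ) (h0 : F 0 = 0) (N : ℕ) :
    ∑ n ∈ Ioc 0 N, F n = ∑ n ∈ range (N + 1), F n := by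
  induction N with
  | zero => simp [h0]
  | succ N ih => rw [sum_Ioc_succ_top (by omega), ih, sum_range_succ _ (N + 1)]

lemma gg_zero {p : ℕ} [Fact p.Prime] (r : (ZMod p)ˣ) : gg r 0 = 0 := by
  have h : (0 : ZMod p) ≠ r := r.ne_zero.symm
  have h' : (0 : ZMod p) ≠ -r := (neg_ne_zero.mpr r.ne_zero).symm
  simp [gg, h, h']

lemma gg_bdd {p : ℕ} [Fact p.Prime] (r : (ZMod p)ˣ) (N : ℕ) :
    |∑ n ∈ Ioc 0 N, gg r (n : ZMod p)| ≤ p := by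
  rw [sum_Ioc_eq_range _ (by simp [gg_zero])]
  have hper : Function.Periodic (fun N => ∑ n ∈ range N, gg r (n : ZMod p)) p := by
    intro N
    simp only
    induction N with
    | zero =>
      rw [zero_add, sum_range_zmod p (gg r)]
      simp [gg]
    | succ N ih =>
      rw [add_right_comm, sum_range_succ, ih, sum_range_succ]
      simp
  have := hper.map_mod_nat (N + 1)
  rw [← this]
  calc _ ≤ ∑ n ∈ range ((N + 1) % p), |gg r (n : ZMod p)| := abs_sum_le_sum_abs _ _
    _ ≤ ∑ n ∈ range ((N + 1) % p), 1 := sum_le_sum fun _ _ => abs_gg_le _ _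
    _ ≤ p := by
      simp only [sum_const, card_range, nsmul_eq_mul, mul_one]
      exact_mod_cast (Nat.mod_lt _ (Fact.out : p.Prime).pos).le

lemma gg_sum_mul {p : ℕ} [Fact p.Prime] (hp : p ≠ 2) (r : (ZMod p)ˣ) (a b : ZMod p) :
    ∑ s : (ZMod p)ˣ, gg s a * gg (r * s⁻¹) b = 2 * gg r (a * b) := by
  by_cases ha : a = 0
  · subst ha
    simp [gg_zero]
  obtain ⟨t, rfl⟩ : ∃ t : (ZMod p)ˣ, (t : ZMod p) = a := ⟨Units.mk0 a ha, rfl⟩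
  have h1 : ∀ s : (ZMod p)ˣ, gg s (t : ZMod p) =
      (if t = s then 1 else 0) - (if -t = s then 1 else 0) := by
    intro s
    have e1 : ((t : ZMod p) = s) ↔ t = s := Units.val_inj
    have e2 : ((t : ZMod p) = -s) ↔ -t = s := by
      rw [← Units.val_neg, Units.val_inj, neg_eq_iff_eq_neg]
    simp only [gg, e1, e2]
  simp only [h1, sub_mul, sum_sub_distrib, ite_mul, one_mul, zero_mul, sum_ite_eq, mem_univ, if_true]
  have e3 : (b = (r : ZMod p) * (t⁻¹ : (ZMod p)ˣ)) ↔ (t : ZMod p) * b = r := by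
    rw [Units.eq_mul_inv_iff_mul_eq, mul_comm]
  have e4 : (b = -((r : ZMod p) * (t⁻¹ : (ZMod p)ˣ))) ↔ (t : ZMod p) * b = -r := by
    rw [← neg_mul, Units.eq_mul_inv_iff_mul_eq, mul_comm]
  simp only [gg, inv_neg, Units.val_mul, Units.val_neg, mul_neg, neg_neg, e3, e4]
  ring

lemma dk_eq (k : ℕ) {n : ℕ} (hn : n ≠ 0) : dk k n = (Nat.finMulAntidiag k n).card := by
  unfold dk
  congr 1
  ext f
  simp only [mem_filter, Fintype.mem_piFinset, mem_range, Nat.mem_finMulAntidiag]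
  constructor
  · rintro ⟨_, h⟩; exact ⟨h, hn⟩
  · rintro ⟨h, _⟩
    refine ⟨fun i => Nat.lt_succ_of_le (Nat.le_of_dvd (Nat.pos_of_ne_zero hn) ?_), h⟩
    rw [← h]
    exact dvd_prod_of_mem _ (mem_univ i)

lemma dk_succ (k : ℕ) {n : ℕ} (hn : n ≠ 0) :
    dk (k + 1) n = ∑ x ∈ n.divisorsAntidiagonal, dk k x.2 := by
  have : ∀ x ∈ n.divisorsAntidiagonal, dk k x.2 = (Nat.finMulAntidiag k x.2).card := by
    intro x hx
    rw [Nat.mem_divisorsAntidiagonal] at hx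
    apply dk_eq
    rintro h
    apply hx.2
    rw [← hx.1, h, mul_zero]
  rw [sum_congr rfl this, ← card_sigma, dk_eq _ hn]
  refine card_nbij' (fun f => ⟨(f 0, ∏ i, Fin.tail f i), Fin.tail f⟩)
    (fun y => Fin.cons y.1.1 y.2) ?_ ?_ ?_ ?_
  · intro f hf
    simp only [coe_sigma, Set.mem_sigma_iff, mem_coe, Nat.mem_finMulAntidiag,
      Nat.mem_divisorsAntidiagonal] at hf ⊢
    have h := hf.1
    rw [Fin.prod_univ_succ] at h
    refine ⟨⟨h, hn⟩, trivial, ?_⟩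
    rintro h0
    apply hn
    rw [← h]
    unfold Fin.tail at h0
    rw [h0, mul_zero]
  · rintro ⟨⟨a, b⟩, f⟩ hf
    simp only [coe_sigma, Set.mem_sigma_iff, mem_coe, Nat.mem_finMulAntidiag,
      Nat.mem_divisorsAntidiagonal] at hf ⊢
    rw [Fin.prod_univ_succ]
    simp [hf.2.1, hf.1.1, hn]
  · intro f _
    simp
  · rintro ⟨⟨a, b⟩, f⟩ hf
    simp only [coe_sigma, Set.mem_sigma_iff, mem_coe, Nat.mem_finMulAntidiag,
      Nat.mem_divisorsAntidiagonal] at hf ⊢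
    obtain ⟨_, h, _⟩ := hf
    simp [h]

lemma dk_one {n : ℕ} (hn : n ≠ 0) : dk 1 n = 1 := by
  rw [dk_eq _ hn, card_eq_one]
  refine ⟨fun _ => n, ?_⟩
  ext f
  simp only [Nat.mem_finMulAntidiag, mem_singleton, Fin.prod_univ_one]
  constructor
  · rintro ⟨h, _⟩; ext i; rw [← h, Subsingleton.elim i 0]
  · rintro rfl; exact ⟨rfl, hn⟩

noncomputable def uu {p : ℕ} (k : ℕ) (r : (ZMod p)ˣ) : ArithmeticFunction ℝ :=
  ⟨fun n => dk k n * gg r (n : ZMod p) / n, by simp⟩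

noncomputable def DD (k : ℕ) : ArithmeticFunction ℝ := ⟨fun n => dk k n / n, by simp⟩

lemma uu_apply {p : ℕ} (k : ℕ) (r : (ZMod p)ˣ) (n : ℕ) :
    uu k r n = dk k n * gg r (n : ZMod p) / n := rfl

lemma DD_apply (k n : ℕ) : DD k n = dk k n / n := rfl

lemma DD_succ (k : ℕ) : DD (k + 1) = DD 1 * DD k := by
  ext n
  by_cases hn : n = 0
  · simp [hn]
  rw [ArithmeticFunction.mul_apply, DD_apply, dk_succ k hn]
  push_cast
  rw [sum_div]
  refine sum_congr rfl fun x hx => ?_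
  rw [Nat.mem_divisorsAntidiagonal] at hx
  have h1 : x.1 ≠ 0 := by rintro h; apply hx.2; rw [← hx.1, h, zero_mul]
  rw [DD_apply, DD_apply, dk_one h1, ← hx.1]
  push_cast
  rw [div_mul_div_comm, one_mul]

lemma LogBdd_DD (k : ℕ) : LogBdd (DD (k + 1)) := by
  have h1 : LogBdd (DD 1) := by
    refine ⟨1, 1, fun N hN => ?_⟩
    rw [one_mul, pow_one]
    refine le_trans (le_of_eq (sum_congr rfl fun n hn => ?_)) (sum_inv_le N hN)
    rw [mem_Ioc] at hn
    rw [DD_apply, dk_one hn.1.ne', abs_of_nonneg (by positivity)]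
    simp
  induction k with
  | zero => exact h1
  | succ k ih => rw [DD_succ]; exact h1.mul ih

lemma LogBdd_uu {p : ℕ} (k : ℕ) (r : (ZMod p)ˣ) : LogBdd (uu (k + 1) r) := by
  refine (LogBdd_DD k).mono fun n => ?_
  rw [uu_apply, DD_apply, abs_div, abs_div, abs_mul]
  gcongr
  exact mul_le_of_le_one_right (abs_nonneg _) (abs_gg_le _ _)

lemma af_sum_apply {ι : Type*} (s : Finset ι) (f : ι → ArithmeticFunction ℝ) (n : ℕ) :
    (∑ i ∈ s, f i) n = ∑ i ∈ s, f i n := by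
  classical
  induction s using Finset.induction_on with
  | empty => simp
  | insert a s ha ih => rw [sum_insert ha, sum_insert ha, ArithmeticFunction.add_apply, ih]

lemma uu_succ {p : ℕ} [Fact p.Prime] (hp : p ≠ 2) (k : ℕ) (r : (ZMod p)ˣ) (n : ℕ) :
    uu (k + 1) r n = (1 / 2) * (∑ s : (ZMod p)ˣ, uu 1 s * uu k (r * s⁻¹)) n := by
  by_cases hn : n = 0
  · simp [hn]
  have e : (∑ s : (ZMod p)ˣ, uu 1 s * uu k (r * s⁻¹)) n =
      ∑ s : (ZMod p)ˣ, (uu 1 s * uu k (r * s⁻¹)) n := af_sum_apply _ _ _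
  rw [e]
  simp only [ArithmeticFunction.mul_apply]
  rw [sum_comm, uu_apply, dk_succ k hn]
  push_cast
  rw [sum_mul, sum_div, mul_sum]
  refine sum_congr rfl fun x hx => ?_
  rw [Nat.mem_divisorsAntidiagonal] at hx
  have h1 : x.1 ≠ 0 := by rintro h; apply hx.2; rw [← hx.1, h, zero_mul]
  simp only [uu_apply, dk_one h1]
  have h := gg_sum_mul hp r (x.1 : ZMod p) (x.2 : ZMod p)
  rw [← hx.1]
  push_cast
  have h2 : gg r ((x.1 : ZMod p) * x.2) = (1 / 2) *
    ∑ s : (ZMod p)ˣ, gg s (x.1 : ZMod p) * gg (r * s⁻¹) (x.2 : ZMod p) := by rw [h]; ring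
  rw [h2]
  simp only [mul_sum, sum_div]
  refine sum_congr rfl fun s _ => ?_
  rw [div_mul_div_comm]
  ring

lemma cot_tendsto {x : ℝ} (h0 : 0 < x) (h1 : x < 1) :
    Filter.Tendsto (fun M : ℕ => ∑ j ∈ range M, (1 / (x + j) + 1 / (x - (j + 1))))
      Filter.atTop (nhds (π * Real.cot (π * x))) := by
  have hx : (x : ℂ) ∈ Complex.integerComplement := by
    rw [Complex.mem_integerComplement_iff]
    rintro ⟨n, hn⟩
    have : (n : ℝ) = x := by exact_mod_cast hn
    rw [← this] at h0 h1
    have a1 : 0 < n := by exact_mod_cast h0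
    have a2 : n < 1 := by exact_mod_cast h1
    omega
  have h := tendsto_logDeriv_euler_cot_sub hx
  have h' : Filter.Tendsto (fun M : ℕ => ∑ j ∈ range M, (1 / (x - (j + 1)) + 1 / (x + (j + 1))))
      Filter.atTop (nhds (π * Real.cot (π * x) - 1 / x)) := by
    rw [← Filter.tendsto_ofReal_iff]
    push_cast
    exact h
  have h2 : Filter.Tendsto (fun M : ℕ => 1 / (x + (M : ℝ))) Filter.atTop (nhds 0) := by
    apply Filter.Tendsto.const_div_atTop
    exact Filter.tendsto_atTop_add_const_left _ _ tendsto_natCast_atTop_atTop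
  have h3 := (h'.add_const (1 / x)).sub h2
  rw [sub_add_cancel, sub_zero] at h3
  refine h3.congr fun M => ?_
  induction M with
  | zero => simp
  | succ M ih =>
    rw [sum_range_succ, sum_range_succ, ← ih]
    push_cast
    ring

lemma uu_one_block {p : ℕ} [Fact p.Prime] (r : (ZMod p)ˣ) (M : ℕ) :
    ∑ n ∈ range (p * M), gg r (n : ZMod p) / n =
      (1 / p) * ∑ j ∈ range M, (1 / (((r : ZMod p).val : ℝ) / p + j)
        + 1 / (((r : ZMod p).val : ℝ) / p - (j + 1))) := by
  have hp0 : (p : ℝ) ≠ 0 := by exact_mod_cast (Fact.out : p.Prime).ne_zero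
  have hlt : (r : ZMod p).val < p := ZMod.val_lt _
  have hpos : 0 < (r : ZMod p).val := by
    rw [ZMod.val_pos]; exact r.ne_zero
  induction M with
  | zero => simp
  | succ M ih =>
    rw [mul_add, mul_one, sum_range_add, ih, sum_range_succ, mul_add]
    congr 1
    have hnv : (-(r : ZMod p)).val = p - (r : ZMod p).val := by
      haveI : NeZero (r : ZMod p) := ⟨r.ne_zero⟩
      exact ZMod.val_neg_of_ne_zero _
    have e : ∀ i ∈ range p, gg r ((p * M + i : ℕ) : ZMod p) / ((p * M + i : ℕ) : ℝ) =
        (if i = (r : ZMod p).val then 1 / ((p * M + i : ℕ) : ℝ) else 0)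
        - (if i = p - (r : ZMod p).val then 1 / ((p * M + i : ℕ) : ℝ) else 0) := by
      intro i hi
      rw [mem_range] at hi
      have c : ((p * M + i : ℕ) : ZMod p) = (i : ZMod p) := by simp
      have e1 : ∀ y : ZMod p, ((i : ZMod p) = y) ↔ i = y.val := by
        intro y
        constructor
        · rintro rfl; exact (ZMod.val_cast_of_lt hi).symm
        · rintro rfl; simp
      rw [c]
      simp only [gg, e1, hnv, sub_div, ite_div, zero_div]
    rw [sum_congr rfl e, sum_sub_distrib, sum_ite_eq', sum_ite_eq', if_pos (by simpa using hlt),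
      if_pos (by simp; omega)]
    push_cast [hlt.le]
    set a : ℝ := ((r : ZMod p).val : ℝ)
    have ha : 0 < a := Nat.cast_pos.mpr hpos
    have hap : a < p := Nat.cast_lt.mpr hlt
    have hpp : (0 : ℝ) < p := ha.trans hap
    have q1 : (p * M + a : ℝ) ≠ 0 := by positivity
    have hpM : (0 : ℝ) ≤ p * M := by positivity
    have q2 : (p * M + (p - a) : ℝ) ≠ 0 := by
      have : (0 : ℝ) < p * M + (p - a) := by linarith
      exact this.ne'
    have f1 : a / p + M = (p * M + a) / p := by field_simp; ring
    have f2 : a / p - (M + 1) = -(p * M + (p - a)) / p := by field_simp; ring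
    rw [f1, f2]
    field_simp
    ring

lemma FastConv_one {p : ℕ} [Fact p.Prime] (r : (ZMod p)ˣ) :
    FastConv (uu 1 r) (π * Real.cot (π * ((r : ZMod p).val : ℝ) / p) / p) := by
  set A := π * Real.cot (π * ((r : ZMod p).val : ℝ) / p) / p with hA
  have hp := (Fact.out : p.Prime)
  have hlt : (r : ZMod p).val < p := ZMod.val_lt _
  have hpos : 0 < (r : ZMod p).val := by
    rw [ZMod.val_pos]; exact r.ne_zero
  have hpp : (0 : ℝ) < p := by exact_mod_cast hp.pos
  have hs : ∀ N, ∑ n ∈ Ioc 0 N, uu 1 r n = ∑ n ∈ Ioc 0 N, gg r (n : ZMod p) / n := by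
    intro N
    refine sum_congr rfl fun n hn => ?_
    rw [mem_Ioc] at hn
    rw [uu_apply, dk_one hn.1.ne']
    simp
  have hlim : Filter.Tendsto (fun M : ℕ => ∑ n ∈ range (p * M), gg r (n : ZMod p) / n)
      Filter.atTop (nhds A) := by
    have h := (cot_tendsto (x := ((r : ZMod p).val : ℝ) / p) (by positivity)
      (by rw [div_lt_one hpp]; exact_mod_cast hlt)).const_mul (1 / (p : ℝ))
    simp only [← uu_one_block] at h
    convert h using 2
    rw [hA, mul_div_assoc π ((r : ZMod p).val : ℝ)]
    ring
  have hbound : ∀ M : ℕ, |∑ n ∈ Ioc 0 M, uu 1 r n - A| ≤ 2 * p / (M + 1) := by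
    intro M
    have ht := ((hlim.sub_const (∑ n ∈ Ioc 0 M, gg r (n : ZMod p) / n)).abs)
    rw [hs, abs_sub_comm]
    refine le_of_tendsto ht ?_
    filter_upwards [Filter.eventually_gt_atTop M] with K hK
    have hK' : M + 1 ≤ p * K := by nlinarith [hp.one_lt]
    obtain ⟨d, hd⟩ := Nat.exists_eq_add_of_le hK'
    have := abel_tail (fun n => gg r (n : ZMod p)) p (gg_bdd r) M d
    rw [sum_Ioc_eq_range _ (by simp) (M + d), show M + d + 1 = p * K by omega] at this
    exact this
  intro j
  obtain ⟨C, hC⟩ := ell_pow_le j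
  refine ⟨2 * p * C, fun N hN => ?_⟩
  have hN' : (0 : ℝ) < N := by exact_mod_cast hN
  have h0 : 0 ≤ ell N ^ j := pow_nonneg (zero_le_one.trans ell_one_le) _
  calc _ ≤ 2 * p / (N + 1) * ell N ^ j := mul_le_mul_of_nonneg_right (hbound N) h0
    _ ≤ 2 * p / N * (C * N) := by
      apply mul_le_mul _ (hC N hN) h0 (by positivity)
      gcongr; linarith
    _ = _ := by field_simp

lemma xk_zero (p : ℕ) [NeZero p] (r : ZMod p) : xk 0 p r = if 1 = r then 1 else 0 := by
  unfold xk
  rw [sum_filter]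
  simp

lemma xk_succ (k p : ℕ) [NeZero p] (r : (ZMod p)ˣ) :
    xk (k + 1) p (r : ZMod p) = ∑ s : (ZMod p)ˣ,
      (Real.cot (π * ((s : ZMod p).val : ℝ) / p) / p) * xk k p ((r * s⁻¹ : (ZMod p)ˣ) : ZMod p) := by
  unfold xk
  rw [sum_filter, ← (Fin.consEquiv fun _ : Fin (k + 1) => (ZMod p)ˣ).sum_comp, Fintype.sum_prod_type,
    mul_sum]
  refine sum_congr rfl fun s _ => ?_
  rw [sum_filter, mul_sum, mul_sum, mul_sum]
  refine sum_congr rfl fun m _ => ?_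
  simp only [Fin.consEquiv, Equiv.coe_fn_mk, Fin.prod_univ_succ, Fin.cons_zero, Fin.cons_succ]
  have e : (s : ZMod p) * ∏ i, (m i : ZMod p) = r ↔
      ∏ i, (m i : ZMod p) = ((r * s⁻¹ : (ZMod p)ˣ) : ZMod p) := by
    rw [Units.val_mul, Units.eq_mul_inv_iff_mul_eq, mul_comm]
  simp only [e]
  split_ifs
  · rw [pow_succ]; ring
  · simp

lemma xk_one (p : ℕ) [NeZero p] (r : (ZMod p)ˣ) :
    xk 1 p (r : ZMod p) = Real.cot (π * ((r : ZMod p).val : ℝ) / p) / p := by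
  rw [xk_succ 0 p r, sum_eq_single r]
  · simp [xk_zero]
  · intro s _ hs
    rw [xk_zero, if_neg, mul_zero]
    rw [← Units.val_one, Units.val_inj, eq_mul_inv_iff_mul_eq, one_mul]
    exact hs
  · simp

lemma main_conv {p : ℕ} [NeZero p] [Fact p.Prime] (hp : p ≠ 2) (k : ℕ) : ∀ r : (ZMod p)ˣ,
    FastConv (uu (k + 1) r) (2 * (π / 2) ^ (k + 1) * xk (k + 1) p (r : ZMod p)) := by
  induction k with
  | zero =>
    intro r
    have h := FastConv_one r
    convert h using 1
    rw [zero_add, xk_one]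
    ring
  | succ k ih =>
    intro r
    have h := FastConv.smul (1 / 2) (FastConv.sum univ fun s _ =>
      (FastConv_one s).mul (ih (r * s⁻¹)) (LogBdd_uu 0 s) (LogBdd_uu k _))
      (uu (k + 1 + 1) r) (uu_succ hp (k + 1) r)
    convert h using 1
    rw [xk_succ (k + 1) p r, mul_sum, mul_sum]
    refine sum_congr rfl fun s _ => ?_
    ring

lemma sum_int_eq {p : ℕ} (k : ℕ) (r : (ZMod p)ˣ) (X : ℕ) :
    ∑ n ∈ (Finset.Icc (-(X : ℤ)) (X : ℤ)).filter
            (fun n : ℤ => n ≠ 0 ∧ (Int.cast n : ZMod p) = (r : ZMod p)),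
          (dk k n.natAbs : ℝ) / (n : ℝ) = ∑ n ∈ Ioc 0 X, uu k r n := by
  rw [sum_filter]
  induction X with
  | zero => simp
  | succ X ih =>
    rw [sum_Ioc_succ_top (by omega), ← ih, Nat.cast_add, Nat.cast_one, Icc_succ_succ,
      sum_union (by simp), sum_pair (by lia)]
    congr 1
    have e1 : (-((X : ℤ) + 1)).natAbs = X + 1 := by omega
    have e2 : ((X : ℤ) + 1).natAbs = X + 1 := by omega
    have n1 : (-((X : ℤ) + 1)) ≠ 0 := by omega
    have n2 : ((X : ℤ) + 1) ≠ 0 := by omega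
    simp only [e1, e2, n1, n2, uu_apply, gg, ne_eq, not_false_eq_true, true_and]
    push_cast
    simp only [neg_eq_iff_eq_neg, div_neg]
    split_ifs <;> ring

theorem stmt0 (p k : ℕ) [NeZero p] (hp : p.Prime) (hodd : Odd p) (hk : 0 < k)
    (r : ℤ) (hr : Int.gcd r p = 1) :
    ∃ L : ℝ,
      Filter.Tendsto
        (fun X : ℕ => ∑ n ∈ (Finset.Icc (-(X : ℤ)) (X : ℤ)).filter
            (fun n : ℤ => n ≠ 0 ∧ (Int.cast n : ZMod p) = (r : ZMod p)),
          (dk k n.natAbs : ℝ) / (n : ℝ))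
        Filter.atTop (nhds L) ∧
      xk k p (r : ZMod p) = (1 / 2) * (2 / π) ^ k * L := by
  haveI : Fact p.Prime := ⟨hp⟩
  have hp2 : p ≠ 2 := by rintro rfl; exact absurd hodd (by decide)
  have hr0 : (r : ZMod p) ≠ 0 := by
    intro h
    rw [ZMod.intCast_zmod_eq_zero_iff_dvd] at h
    have h2 := Int.dvd_gcd h (dvd_refl (p : ℤ))
    rw [hr] at h2
    have : p ∣ 1 := by exact_mod_cast h2
    exact hp.one_lt.ne' (Nat.dvd_one.mp this)
  obtain ⟨t, ht⟩ : ∃ t : (ZMod p)ˣ, (t : ZMod p) = (r : ZMod p) := ⟨Units.mk0 _ hr0, rfl⟩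
  obtain ⟨k, rfl⟩ : ∃ j, k = j + 1 := ⟨k - 1, by omega⟩
  rw [← ht]
  refine ⟨2 * (π / 2) ^ (k + 1) * xk (k + 1) p (t : ZMod p), ?_, ?_⟩
  · simp only [sum_int_eq]
    exact (main_conv hp2 k t).tendsto
  · have : (2 / π) ^ (k + 1) * (π / 2) ^ (k + 1) = 1 := by
      rw [← mul_pow, div_mul_div_comm, mul_comm π 2, div_self (by positivity), one_pow]
    linear_combination (-xk (k + 1) p (t : ZMod p)) * this
end

section
/- Let χ be a primitive odd Dirichlet character modulo a prime p. Then L(1,χ) = (π/(2p)) · Σ_{m=1}^{p-1} χ(m) cot(π m/p). Moreover, if χ is a nontrivial even character mod p, then Σ_{m=1}^{p-1} χ(m) cot(π m/p) = 0. -/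
open scoped Real

theorem aux_diff (u s : ℝ) (hu : 0 < u) (h1 : 1 ≤ s) (h2 : s ≤ 2) :
    u ^ (-s) - (u + 1) ^ (-s) ≤ 2 / u ^ 2 := by
  have hA : u ^ (-s) ≤ u⁻¹ + (u ^ 2)⁻¹ := by
    rcases le_total 1 u with h | h
    · have : u ^ (-s) ≤ u ^ (-1 : ℝ) := Real.rpow_le_rpow_of_exponent_le h (by linarith)
      rw [Real.rpow_neg_one] at this
      have : 0 ≤ (u ^ 2)⁻¹ := by positivity
      linarith
    · have : u ^ (-s) ≤ u ^ (-2 : ℝ) := Real.rpow_le_rpow_of_exponent_ge hu h (by linarith)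
      rw [Real.rpow_neg hu.le 2, Real.rpow_two] at this
      have : 0 ≤ u⁻¹ := by positivity
      linarith
  have hB : (u + 1) ^ (-s) = u ^ (-s) * (u / (u + 1)) ^ s := by
    rw [Real.div_rpow hu.le (by positivity), Real.rpow_neg hu.le, Real.rpow_neg (by positivity)]
    have : u ^ s ≠ 0 := by positivity
    field_simp
  have hC : 1 - 2 / (u + 1) ≤ (u / (u + 1)) ^ s := by
    have h3 : (u / (u + 1)) ^ (2 : ℝ) ≤ (u / (u + 1)) ^ s :=
      Real.rpow_le_rpow_of_exponent_ge (by positivity)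
        (by rw [div_le_one (by positivity)]; linarith) h2
    rw [Real.rpow_two] at h3
    have h4 : u / (u + 1) = 1 - 1 / (u + 1) := by field_simp; ring
    have h5 : 2 / (u + 1) = 2 * (1 / (u + 1)) := by ring
    rw [h4] at h3 ⊢
    rw [h5]
    nlinarith [sq_nonneg (1 / (u + 1))]
  have hD : 0 ≤ u ^ (-s) := by positivity
  calc u ^ (-s) - (u + 1) ^ (-s) = u ^ (-s) * (1 - (u / (u + 1)) ^ s) := by rw [hB]; ring
    _ ≤ u ^ (-s) * (2 / (u + 1)) := by gcongr; linarith
    _ ≤ (u⁻¹ + (u ^ 2)⁻¹) * (2 / (u + 1)) := by gcongr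
    _ = 2 / u ^ 2 := by field_simp

theorem aux_abs (u x y s : ℝ) (hu : 0 < u) (h1 : 1 ≤ s) (h2 : s ≤ 2)
    (hx : u ≤ x) (hx' : x ≤ u + 1) (hy : u ≤ y) (hy' : y ≤ u + 1) :
    |(x ^ (-s) - y ^ (-s)) / 2| ≤ 2 / u ^ 2 := by
  have h := aux_diff u s hu h1 h2
  have m : ∀ a b : ℝ, 0 < a → a ≤ b → b ^ (-s) ≤ a ^ (-s) := fun a b ha hab =>
    Real.rpow_le_rpow_of_nonpos ha hab (by linarith)
  have a1 := m u x hu hx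
  have a2 := m x (u+1) (by linarith) hx'
  have a3 := m u y hu hy
  have a4 := m y (u+1) (by linarith) hy'
  rw [abs_le]
  constructor <;> linarith

theorem aux_cot (a : ℝ) (h0 : 0 < a) (h1 : a < 1) :
    HurwitzZeta.hurwitzZetaOdd (a : UnitAddCircle) 1 = π / 2 * Complex.cot (π * a) := by
  obtain ⟨c, hc, hca, hca'⟩ : ∃ c : ℝ, 0 < c ∧ c ≤ a ∧ c ≤ 1 - a :=
    ⟨min a (1 - a), lt_min h0 (by linarith), min_le_left _ _, min_le_right _ _⟩
  let g : ℝ → ℕ → ℝ := fun s n => ((n + a) ^ (-s) - (n + 1 - a) ^ (-s)) / 2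
  have hb : ∀ s n, 1 ≤ s → s ≤ 2 → ‖g s n‖ ≤ 2 / (n + c) ^ 2 := by
    intro s n hs hs'
    have hn : (0 : ℝ) ≤ n := n.cast_nonneg
    exact aux_abs (n + c) (n + a) (n + 1 - a) s (by linarith) hs hs' (by linarith)
      (by linarith) (by linarith) (by linarith)
  have hsum : Summable (fun n : ℕ => 2 / ((n : ℝ) + c) ^ 2) := by
    have := ((Real.summable_one_div_nat_add_rpow c 2).2 (by norm_num)).mul_left 2
    refine this.congr fun n => ?_
    rw [Real.rpow_two, sq_abs]; ring
  have hlim : Filter.Tendsto (fun s => ∑' n, g s n) (nhdsWithin 1 (Set.Ioi 1))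
      (nhds (∑' n, g 1 n)) := by
    refine tendsto_tsum_of_dominated_convergence hsum (fun n => ?_) ?_
    · have hn : (0 : ℝ) ≤ n := n.cast_nonneg
      have hx : (n : ℝ) + a ≠ 0 := by linarith
      have hy : (n : ℝ) + 1 - a ≠ 0 := by linarith
      have : Continuous (fun s => g s n) := by
        simp only [g]
        refine Continuous.div_const (Continuous.sub ?_ ?_) _
        · exact Continuous.rpow continuous_const continuous_neg (fun _ => Or.inl hx)
        · exact Continuous.rpow continuous_const continuous_neg (fun _ => Or.inl hy)
      exact (this.tendsto 1).mono_left nhdsWithin_le_nhds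
    · filter_upwards [Ioo_mem_nhdsGT (show (1 : ℝ) < 2 by norm_num)] with s hs n
      exact hb s n hs.1.le hs.2.le
  have hval : ∀ s : ℝ, 1 < s → HurwitzZeta.hurwitzZetaOdd (a : UnitAddCircle) (s : ℂ) =
      ((∑' n, g s n : ℝ) : ℂ) := by
    intro s hs
    rw [← (HurwitzZeta.hasSum_nat_hurwitzZetaOdd_of_mem_Icc (a := a) ⟨h0.le, h1.le⟩ (s := s)
      (by simpa using hs)).tsum_eq, Complex.ofReal_tsum]
    congr 1
    ext n
    have hn : (0 : ℝ) ≤ n := n.cast_nonneg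
    simp only [g]
    push_cast
    rw [Complex.ofReal_cpow (by linarith), Complex.ofReal_cpow (by linarith)]
    push_cast
    rw [Complex.cpow_neg, Complex.cpow_neg]
    simp
  have hodd : HurwitzZeta.hurwitzZetaOdd (a : UnitAddCircle) 1 = ((∑' n, g 1 n : ℝ) : ℂ) := by
    have t1 : Filter.Tendsto (fun s : ℝ => HurwitzZeta.hurwitzZetaOdd (a : UnitAddCircle) (s : ℂ))
        (nhdsWithin 1 (Set.Ioi 1)) (nhds (HurwitzZeta.hurwitzZetaOdd (a : UnitAddCircle) 1)) := by
      have : Continuous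
          (fun s : ℝ => HurwitzZeta.hurwitzZetaOdd (a : UnitAddCircle) (s : ℂ)) :=
        (HurwitzZeta.differentiable_hurwitzZetaOdd _).continuous.comp Complex.continuous_ofReal
      have h := (this.tendsto 1).mono_left (nhdsWithin_le_nhds (s := Set.Ioi 1))
      simpa using h
    have t2 := (Complex.continuous_ofReal.tendsto _).comp hlim
    refine tendsto_nhds_unique t1 (t2.congr' ?_)
    filter_upwards [self_mem_nhdsWithin] with s hs
    exact (hval s hs).symm
  have hs1 : HasSum (fun n => ((g 1 n : ℝ) : ℂ)) ((∑' n, g 1 n : ℝ) : ℂ) := by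
    rw [Complex.hasSum_ofReal]
    exact (Summable.of_norm_bounded hsum fun n => hb 1 n le_rfl (by norm_num)).hasSum
  have hmem : (a : ℂ) ∈ Complex.integerComplement := by
    rintro ⟨k, hk⟩
    have hk' : (k : ℝ) = a := by exact_mod_cast hk
    rw [← hk'] at h0 h1
    have a1 : 0 < k := by exact_mod_cast h0
    have a2 : k < 1 := by exact_mod_cast h1
    omega
  have hcot := tendsto_logDeriv_euler_cot_sub hmem
  have hpart : ∀ N : ℕ, 2 * ∑ n ∈ Finset.range N, ((g 1 n : ℝ) : ℂ) =
      1 / (a : ℂ) + ∑ j ∈ Finset.range N, cotTerm a j - ((1 / (N + a) : ℝ) : ℂ) := by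
    intro N
    induction N with
    | zero => simp
    | succ N ih =>
      rw [Finset.sum_range_succ, Finset.sum_range_succ, mul_add, ih]
      simp only [g, cotTerm, Real.rpow_neg_one]
      push_cast
      rw [show (a : ℂ) - (N + 1) = -(N + 1 - a) by ring, one_div (-((N : ℂ) + 1 - a)), inv_neg,
        show (a : ℂ) + (N + 1) = N + 1 + a by ring]
      ring
  have hz : Filter.Tendsto (fun N : ℕ => ((1 / (N + a) : ℝ) : ℂ)) Filter.atTop (nhds 0) := by
    have : Filter.Tendsto (fun N : ℕ => (1 / (N + a) : ℝ)) Filter.atTop (nhds 0) :=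
      Filter.Tendsto.div_atTop tendsto_const_nhds
        (Filter.tendsto_atTop_add_const_right _ _ tendsto_natCast_atTop_atTop)
    have h := (Complex.continuous_ofReal.tendsto 0).comp this
    simpa [Function.comp_def] using h
  have l1 := hs1.tendsto_sum_nat.const_mul (2 : ℂ)
  have l2 := (hcot.const_add (1 / (a : ℂ))).sub hz
  have := tendsto_nhds_unique l1 (l2.congr fun N => (hpart N).symm)
  rw [hodd]
  linear_combination this / 2

theorem aux_sum (p : ℕ) [NeZero p] (hp : p.Prime) (F : ZMod p → ℂ) (h0 : F 0 = 0) :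
    ∑ j : ZMod p, F j = ∑ m ∈ Finset.Icc 1 (p - 1), F m := by
  have hp0 := hp.pos
  rw [← Finset.sum_subset (Finset.subset_univ (Finset.univ.erase (0 : ZMod p)))
    (by intro x _ hx; simp at hx; rw [hx, h0])]
  refine Finset.sum_bij' (fun j _ => j.val) (fun m _ => (m : ZMod p)) ?_ ?_ ?_ ?_ ?_
  · intro j hj
    have h1 : j.val ≠ 0 := by simpa using hj
    have := j.val_lt
    simp only [Finset.mem_Icc]
    omega
  · intro m hm
    simp only [Finset.mem_Icc] at hm
    simp only [Finset.mem_erase, Finset.mem_univ, and_true]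
    rw [Ne, ZMod.natCast_eq_zero_iff]
    exact fun h => absurd (Nat.le_of_dvd (by omega) h) (by omega)
  · intro j _
    simp
  · intro m hm
    simp only [Finset.mem_Icc] at hm
    exact ZMod.val_cast_of_lt (by omega)
  · intro j _
    simp

theorem stmt5 (p : ℕ) [NeZero p] (hp : p.Prime) (χ : DirichletCharacter ℂ p) :
    (χ (-1) = -1 →
      DirichletCharacter.LFunction χ 1 =
        (π / (2 * p)) * ∑ m ∈ Finset.Icc 1 (p - 1), χ m * (Real.cot (π * m / p) : ℂ)) ∧
    (χ (-1) = 1 → χ ≠ 1 →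
      ∑ m ∈ Finset.Icc 1 (p - 1), χ m * (Real.cot (π * m / p) : ℂ) = 0) := by
  have hp0 : (p : ℝ) ≠ 0 := by exact_mod_cast hp.ne_zero
  have hp0' : (p : ℂ) ≠ 0 := by exact_mod_cast hp.ne_zero
  constructor
  · intro h
    have hodd : Function.Odd (χ : ZMod p → ℂ) := by
      intro x
      rw [← neg_one_mul, map_mul, h, neg_one_mul]
    haveI : Fact (1 < p) := ⟨hp.one_lt⟩
    rw [DirichletCharacter.LFunction, ZMod.LFunction_def_odd hodd, aux_sum p hp _
      (by rw [MulChar.map_zero, zero_mul]), Complex.cpow_neg_one, Finset.mul_sum, Finset.mul_sum]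
    refine Finset.sum_congr rfl fun m hm => ?_
    simp only [Finset.mem_Icc] at hm
    have hlt : m < p := by omega
    have hm0 : (0 : ℝ) < m := by exact_mod_cast hm.1
    have hpp : (0 : ℝ) < p := by exact_mod_cast hp.pos
    rw [ZMod.toAddCircle_apply, ZMod.val_cast_of_lt hlt, aux_cot (m / p) (by positivity)
      (by rw [div_lt_one hpp]; exact_mod_cast hlt)]
    push_cast
    rw [mul_div_assoc]
    field_simp
  · intro h _
    have key : ∑ m ∈ Finset.Icc 1 (p - 1), χ m * (Real.cot (π * m / p) : ℂ) =
        ∑ m ∈ Finset.Icc 1 (p - 1), -(χ m * (Real.cot (π * m / p) : ℂ)) := by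
      refine Finset.sum_bij' (fun m _ => p - m) (fun m _ => p - m) ?_ ?_ ?_ ?_ ?_
      · intro m hm; simp only [Finset.mem_Icc] at hm ⊢; omega
      · intro m hm; simp only [Finset.mem_Icc] at hm ⊢; omega
      · intro m hm; simp only [Finset.mem_Icc] at hm ⊢; omega
      · intro m hm; simp only [Finset.mem_Icc] at hm ⊢; omega
      · intro m hm
        simp only [Finset.mem_Icc] at hm
        have hle : m ≤ p := by omega
        have e1 : χ ((p - m : ℕ) : ZMod p) = χ m := by
          rw [Nat.cast_sub hle, ZMod.natCast_self, zero_sub, ← neg_one_mul, map_mul, h, one_mul]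
        have e2 : Real.cot (π * ((p - m : ℕ) : ℝ) / p) = - Real.cot (π * m / p) := by
          rw [Nat.cast_sub hle, show π * ((p : ℝ) - m) / p = π - π * m / p by field_simp,
            Real.cot_eq_cos_div_sin, Real.cot_eq_cos_div_sin, Real.cos_pi_sub, Real.sin_pi_sub,
            neg_div]
        rw [e1, e2]
        push_cast
        ring
    rw [Finset.sum_neg_distrib] at key
    exact self_eq_neg.mp key
end

section
/- Let p be an odd prime. Then Π_{χ odd mod p} L(1,χ) = ( π^{p-1}·(h_p^-)^2·2^{p-1} / (4·p^2·p^{p-2}/p^{(p-3)/2}) )^{1/2}, i.e., the product of L(1,χ) over all odd Dirichlet characters χ mod p equals this explicit expression in terms of the relative class number h_p^- = h_p/h_p^+ of ℚ(ζ_p). -/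
open scoped Real


namespace Stmt16
open Filter Topology NumberField

/-- Ideals supported on a finite set of prime ideals. -/
def suppOn {R : Type*} [CommRing R] (S : Finset (Ideal R)) : Set (Ideal R) :=
  {I | I ≠ ⊥ ∧ ∀ P : Ideal R, P.IsPrime → P ∣ I → P ∈ S}

theorem euler_finite {R : Type*} [CommRing R] [IsDedekindDomain R] (w : Ideal R →* ℝ)
    (hw0 : ∀ I, 0 ≤ w I) (S : Finset (Ideal R))
    (hS : ∀ P ∈ S, P.IsPrime ∧ P ≠ ⊥ ∧ w P < 1) :
    HasSum (fun I : suppOn S => w I) (∏ P ∈ S, (1 - w P)⁻¹) := by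
  classical
  induction S using Finset.induction_on with
  | empty =>
    have h1 : suppOn (∅ : Finset (Ideal R)) = {1} := by
      ext I
      simp only [suppOn, Set.mem_ofPred_eq, Set.mem_singleton_iff, Finset.notMem_empty]
      constructor
      · rintro ⟨h, h'⟩
        by_contra hI
        obtain ⟨M, hM, hle⟩ := Ideal.exists_le_maximal I (by rwa [← Ideal.one_eq_top])
        exact h' M hM.isPrime (Ideal.dvd_iff_le.mpr hle)
      · rintro rfl
        refine ⟨one_ne_zero, fun P hP h => hP.ne_top ?_⟩
        exact Ideal.isUnit_iff.mp (isUnit_of_dvd_one h)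
    rw [h1]
    have := hasSum_fintype (fun I : ({1} : Set (Ideal R)) => w I)
    have h2 : w ⊤ = 1 := by rw [← Ideal.one_eq_top, map_one]
    simpa [h2] using this
  | insert P S hPS ih =>
    have hS' : ∀ P ∈ S, P.IsPrime ∧ P ≠ ⊥ ∧ w P < 1 := fun Q hQ => hS Q (Finset.mem_insert_of_mem hQ)
    obtain ⟨hPp, hP0, hP1⟩ := hS P (Finset.mem_insert_self _ _)
    have hprime : Prime P := Ideal.prime_of_isPrime hP0 hPp
    have ih := ih hS'
    have hnd : ∀ J : suppOn S, ¬ P ∣ J.1 := fun J hJ => hPS (J.2.2 P hPp hJ)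
    let e : ℕ × suppOn S → suppOn (insert P S) := fun x =>
      ⟨P ^ x.1 * x.2.1, mul_ne_zero (pow_ne_zero _ hP0) x.2.2.1, fun Q hQ hd => by
        have hQ0 : Q ≠ ⊥ := by
          rintro rfl
          exact mul_ne_zero (pow_ne_zero _ hP0) x.2.2.1 (zero_dvd_iff.mp hd)
        have hQ' : Prime Q := Ideal.prime_of_isPrime hQ0 hQ
        rcases hQ'.dvd_or_dvd hd with h | h
        · have := hQ'.dvd_of_dvd_pow h
          have : Q = P := associated_iff_eq.mp (hQ'.associated_of_dvd hprime this)
          simp [this]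
        · exact Finset.mem_insert_of_mem (x.2.2.2 Q hQ h)⟩
    have he : Function.Bijective e := by
      constructor
      · rintro ⟨n, J⟩ ⟨m, J'⟩ h
        have h : P ^ n * J.1 = P ^ m * J'.1 := congrArg Subtype.val h
        have key : ∀ (n m : ℕ) (J J' : suppOn S), P ^ n * J.1 = P ^ m * J'.1 → ¬ n < m := by
          intro n m J J' h hlt
          obtain ⟨k, rfl⟩ := Nat.exists_eq_add_of_lt hlt
          rw [add_assoc, pow_add, mul_assoc] at h
          have := mul_left_cancel₀ (pow_ne_zero _ hP0) h
          apply hnd J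
          rw [this, pow_succ']
          exact Dvd.intro _ (by rw [mul_assoc])
        have hnm : n = m := le_antisymm (not_lt.mp (key m n J' J h.symm)) (not_lt.mp (key n m J J' h))
        subst hnm
        have := mul_left_cancel₀ (pow_ne_zero _ hP0) h
        rw [Subtype.ext this]
      · rintro ⟨I, hI0, hI⟩
        have hfin : FiniteMultiplicity P I := FiniteMultiplicity.of_prime_left hprime hI0
        obtain ⟨J, hJ, hJd⟩ := hfin.exists_eq_pow_mul_and_not_dvd
        refine ⟨⟨multiplicity P I, J, ?_, ?_⟩, Subtype.ext hJ.symm⟩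
        · rintro rfl
          exact hJd (dvd_zero _)
        · intro Q hQ hQJ
          have := hI Q hQ (hJ ▸ hQJ.mul_left _)
          rcases Finset.mem_insert.mp this with rfl | h
          · exact absurd hQJ hJd
          · exact h
    rw [Finset.prod_insert hPS]
    have hg := hasSum_geometric_of_lt_one (hw0 P) hP1
    have hm := hg.mul ih (hg.summable.mul_of_nonneg ih.summable
      (fun n => pow_nonneg (hw0 P) n) (fun J => hw0 _))
    rw [← (Equiv.ofBijective e he).hasSum_iff]
    have hcomp : (fun I : suppOn (insert P S) => w I) ∘ (Equiv.ofBijective e he) =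
        fun x => w P ^ x.1 * w x.2 := by
      funext x
      simp [e]
    rw [hcomp]
    exact hm

/-- absNorm weight. -/
noncomputable def wt (K : Type*) [Field K] [NumberField K] (s : ℝ) :
    Ideal (𝓞 K) →* ℝ where
  toFun I := (Ideal.absNorm I : ℝ) ^ (-s)
  map_one' := by simp
  map_mul' I J := by
    rw [map_mul, Nat.cast_mul, Real.mul_rpow (by positivity) (by positivity)]

theorem summable_zeta (K : Type*) [Field K] [NumberField K] (s : ℝ) (hs : 1 < s) :
    LSeriesSummable (fun n ↦ (Nat.card {I : Ideal (𝓞 K) // Ideal.absNorm I = n} : ℂ)) s := by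
  have := LSeriesSummable_of_sum_norm_bigO_and_nonneg (r := 1) (s := s)
    (f := fun n ↦ (Nat.card {I : Ideal (𝓞 K) // Ideal.absNorm I = n} : ℝ)) ?_
    (fun _ => Nat.cast_nonneg _) zero_le_one (by simpa using hs)
  · simpa using this
  · have h := (Ideal.tendsto_norm_le_div_atTop₀ K).comp tendsto_natCast_atTop_atTop
    have h2 := h.isBigO_one ℝ
    have h3 := h2.mul (Asymptotics.isBigO_refl (fun n : ℕ => (n : ℝ)) atTop)
    refine (h3.congr' ?_ ?_)
    · filter_upwards [eventually_gt_atTop 0] with n hn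
      have hn' : (n : ℝ) ≠ 0 := by positivity
      simp only [Function.comp_apply]
      rw [div_mul_cancel₀ _ hn']
      simp only [Nat.cast_le, ← Nat.cast_sum]
      congr
      rw [← add_left_inj 1, ← Ideal.card_norm_le_eq_card_norm_le_add_one,
        show Finset.Icc 1 n = Finset.Ioc 0 n from Finset.Icc_succ_left_eq_Ioc _ _,
        show 1 = Nat.card {I : Ideal (𝓞 K) // Ideal.absNorm I = 0} by simp [Ideal.absNorm_eq_zero_iff],
        Finset.sum_Ioc_add_eq_sum_Icc (n.zero_le),
        ← Finset.card_preimage_eq_sum_card_image_eq (fun k _ ↦ Ideal.finite_setOfPred_absNorm_eq k)]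
      simp [Set.coe_eq_subtype]
    · exact Eventually.of_forall fun n => by simp

theorem hasSum_zeta (K : Type*) [Field K] [NumberField K] (s : ℝ) (hs : 1 < s) :
    ∃ Z : ℝ, dedekindZeta K s = Z ∧
      HasSum (fun I : Ideal (𝓞 K) => (Ideal.absNorm I : ℝ) ^ (-s)) Z := by
  have h := summable_zeta K s hs
  have hterm : ∀ n, LSeries.term (fun n ↦ (Nat.card {I : Ideal (𝓞 K) // Ideal.absNorm I = n} : ℂ)) s n
      = (((Nat.card {I : Ideal (𝓞 K) // Ideal.absNorm I = n} : ℝ) * (n : ℝ) ^ (-s) : ℝ) : ℂ) := by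
    intro n
    rcases eq_or_ne n 0 with rfl | hn
    · have : (0 : ℝ) ^ (-s) = 0 := Real.zero_rpow (by linarith)
      simp [this]
    · rw [LSeries.term_of_ne_zero hn]
      push_cast
      rw [Complex.ofReal_cpow (by positivity)]
      push_cast
      rw [Complex.cpow_neg, div_eq_mul_inv]
  have hs2 : Summable (fun n : ℕ => (Nat.card {I : Ideal (𝓞 K) // Ideal.absNorm I = n} : ℝ) * (n : ℝ) ^ (-s)) := by
    rw [← Complex.summable_ofReal]
    exact h.congr hterm
  have hfin : ∀ n : ℕ, HasSum (fun I : {I : Ideal (𝓞 K) // Ideal.absNorm I = n} => (Ideal.absNorm I.1 : ℝ) ^ (-s))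
      ((Nat.card {I : Ideal (𝓞 K) // Ideal.absNorm I = n} : ℝ) * (n : ℝ) ^ (-s)) := by
    intro n
    rcases eq_or_ne n 0 with rfl | hn
    · have h0 : (0 : ℝ) ^ (-s) = 0 := Real.zero_rpow (by linarith)
      have : (fun I : {I : Ideal (𝓞 K) // Ideal.absNorm I = 0} => (Ideal.absNorm I.1 : ℝ) ^ (-s)) = fun _ => 0 := by
        ext I; rw [I.2]; simp [h0]
      rw [this]; simp [h0]
    · have : Finite {I : Ideal (𝓞 K) // Ideal.absNorm I = n} :=
        Ideal.finite_setOfPred_absNorm_eq n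
      have := Fintype.ofFinite {I : Ideal (𝓞 K) // Ideal.absNorm I = n}
      have h1 : (fun I : {I : Ideal (𝓞 K) // Ideal.absNorm I = n} => (Ideal.absNorm I.1 : ℝ) ^ (-s)) =
        fun _ => (n : ℝ) ^ (-s) := by
        ext I; rw [I.2]
      rw [h1]
      have := hasSum_fintype (fun _ : {I : Ideal (𝓞 K) // Ideal.absNorm I = n} => (n : ℝ) ^ (-s))
      simpa [Nat.card_eq_fintype_card] using this
  refine ⟨∑' n : ℕ, (Nat.card {I : Ideal (𝓞 K) // Ideal.absNorm I = n} : ℝ) * (n : ℝ) ^ (-s), ?_, ?_⟩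
  · rw [dedekindZeta, LSeries, Complex.ofReal_tsum]
    exact tsum_congr hterm
  · let e := Equiv.sigmaFiberEquiv (fun I : Ideal (𝓞 K) => Ideal.absNorm I)
    rw [← e.hasSum_iff]
    have hsum : Summable ((fun I : Ideal (𝓞 K) => (Ideal.absNorm I : ℝ) ^ (-s)) ∘ e) := by
      rw [summable_sigma_of_nonneg (fun _ => by simp only [Function.comp]; positivity)]
      refine ⟨fun n => (hfin n).summable, hs2.congr fun n => ((hfin n).tsum_eq).symm⟩
    have := hsum.hasSum.sigma (fun n => hfin n)
    rw [this.tsum_eq]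
    exact hsum.hasSum

theorem euler_zeta (K : Type*) [Field K] [NumberField K] (s : ℝ) (hs : 1 < s) :
    ∃ Z : ℝ, dedekindZeta K s = Z ∧
      Tendsto (fun N : ℕ => ∏ q ∈ Nat.primesBelow N,
        ∏ P ∈ IsDedekindDomain.primesOverFinset (Ideal.span {(q : ℤ)}) (𝓞 K),
          (1 - (Ideal.absNorm P : ℝ) ^ (-s))⁻¹) atTop (𝓝 Z) := by
  classical
  obtain ⟨Z, hZ, hsum⟩ := hasSum_zeta K s hs
  refine ⟨Z, hZ, ?_⟩
  let w := wt K s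
  have hw0 : ∀ I, 0 ≤ w I := fun I => Real.rpow_nonneg (Nat.cast_nonneg _) _
  let S : ℕ → Finset (Ideal (𝓞 K)) := fun N =>
    (Nat.primesBelow N).biUnion fun q => IsDedekindDomain.primesOverFinset (Ideal.span {(q : ℤ)}) (𝓞 K)
  have hq0 : ∀ q : ℕ, q.Prime → Ideal.span {(q : ℤ)} ≠ ⊥ := by
    intro q hq; simpa using hq.ne_zero
  have hqm : ∀ q : ℕ, q.Prime → (Ideal.span {(q : ℤ)}).IsMaximal := by
    intro q hq
    have := Fact.mk hq
    exact Int.ideal_span_isMaximal_of_prime q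
  have hmem : ∀ q : ℕ, q.Prime → ∀ P : Ideal (𝓞 K),
      P ∈ IsDedekindDomain.primesOverFinset (Ideal.span {(q : ℤ)}) (𝓞 K) ↔
        P.IsPrime ∧ P.LiesOver (Ideal.span {(q : ℤ)}) := by
    intro q hq P
    have := hqm q hq
    rw [IsDedekindDomain.mem_primesOverFinset_iff (hq0 q hq)]
    rfl
  have hne : ∀ q : ℕ, q.Prime → ∀ P : Ideal (𝓞 K), P.LiesOver (Ideal.span {(q : ℤ)}) → P ≠ ⊥ := by
    intro q hq P hP hb
    exact Ideal.ne_bot_of_liesOver_of_ne_bot (hq0 q hq) P hb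
  have hS : ∀ N, ∀ P ∈ S N, P.IsPrime ∧ P ≠ ⊥ ∧ w P < 1 := by
    intro N P hP
    simp only [S, Finset.mem_biUnion] at hP
    obtain ⟨q, hq, hP⟩ := hP
    have hq := Nat.prime_of_mem_primesBelow hq
    rw [hmem q hq] at hP
    refine ⟨hP.1, hne q hq P hP.2, ?_⟩
    apply Real.rpow_lt_one_of_one_lt_of_neg
    · have h0 : Ideal.absNorm P ≠ 0 := by
        rw [Ne, Ideal.absNorm_eq_zero_iff]; exact hne q hq P hP.2
      have h1 : Ideal.absNorm P ≠ 1 := by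
        rw [Ne, Ideal.absNorm_eq_one_iff]; exact hP.1.ne_top
      exact_mod_cast (by omega : 1 < Ideal.absNorm P)
    · linarith
  have hprod : ∀ N, ∏ P ∈ S N, (1 - w P)⁻¹ = ∏ q ∈ Nat.primesBelow N,
        ∏ P ∈ IsDedekindDomain.primesOverFinset (Ideal.span {(q : ℤ)}) (𝓞 K),
          (1 - (Ideal.absNorm P : ℝ) ^ (-s))⁻¹ := by
    intro N
    rw [Finset.prod_biUnion]
    · rfl
    · intro q hq q' hq' hne
      have hq := Nat.prime_of_mem_primesBelow hq
      have hq' := Nat.prime_of_mem_primesBelow hq'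
      rw [Function.onFun, Finset.disjoint_left]
      intro P hP hP'
      rw [hmem q hq] at hP
      rw [hmem q' hq'] at hP'
      have h1 := hP.2.over
      have h2 := hP'.2.over
      rw [← h2, Ideal.span_singleton_eq_span_singleton, Int.associated_iff_natAbs] at h1
      exact hne (by simpa using h1)
  simp_rw [← hprod]
  have hfs := fun N => euler_finite w hw0 (S N) (hS N)
  have h1 : ∀ N, ∏ P ∈ S N, (1 - w P)⁻¹ = ∑' I, (suppOn (S N)).indicator w I := by
    intro N
    rw [← (hfs N).tsum_eq, tsum_subtype (suppOn (S N)) w]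
  simp_rw [h1]
  rw [← hsum.tsum_eq]
  refine tendsto_tsum_of_dominated_convergence (bound := fun I => w I) hsum.summable ?_ ?_
  · intro I
    rcases eq_or_ne I ⊥ with rfl | hI
    · have : w ⊥ = 0 := by
        change ((Ideal.absNorm ⊥ : ℕ) : ℝ) ^ (-s) = 0
        rw [Ideal.absNorm_bot, Nat.cast_zero, Real.zero_rpow (by linarith)]
      have h2 : ((Ideal.absNorm (⊥ : Ideal (𝓞 K)) : ℝ) ^ (-s)) = 0 := this
      rw [h2]
      refine tendsto_const_nhds.congr fun N => ?_
      by_cases h : (⊥ : Ideal (𝓞 K)) ∈ suppOn (S N)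
      · rw [Set.indicator_of_mem h, this]
      · rw [Set.indicator_of_notMem h]
    · refine tendsto_const_nhds.congr' ?_
      filter_upwards [eventually_gt_atTop (Ideal.absNorm I)] with N hN
      rw [Set.indicator_of_mem]
      · rfl
      refine ⟨hI, fun P hP hPI => ?_⟩
      have hP0 : P ≠ ⊥ := by
        rintro rfl
        exact hI (zero_dvd_iff.mp hPI)
      have hPm : P.IsMaximal := hP.isMaximal hP0
      let q := Ideal.absNorm (P.under ℤ)
      have hq : q.Prime := Nat.absNorm_under_prime P
      have hover : P.LiesOver (Ideal.span {(q : ℤ)}) := by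
        refine ⟨?_⟩
        have := Int.ideal_span_absNorm_eq_self (P.under ℤ)
        rw [this]
      have hle : q ≤ Ideal.absNorm I := by
        refine Nat.le_of_dvd (Nat.pos_of_ne_zero ?_) ?_
        · rwa [Ne, Ideal.absNorm_eq_zero_iff]
        · exact (Int.absNorm_under_dvd_absNorm P).trans (map_dvd Ideal.absNorm hPI)
      simp only [S, Finset.mem_biUnion]
      refine ⟨q, ?_, (hmem q hq P).mpr ⟨hP, hover⟩⟩
      rw [Nat.mem_primesBelow]
      exact ⟨by omega, hq⟩
  · refine Eventually.of_forall fun N I => ?_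
    rw [Real.norm_eq_abs, abs_of_nonneg (Set.indicator_nonneg (fun I _ => hw0 I) I)]
    exact Set.indicator_le_self' (fun I _ => hw0 I) I
end Stmt16


namespace Stmt16
open Filter Topology NumberField

theorem prod_primitive {η : ℂ} {d : ℕ} (hd : 0 < d) (h : IsPrimitiveRoot η d) (x : ℂ) :
    ∏ j ∈ Finset.range d, (1 - η ^ j * x) = 1 - x ^ d := by
  have : NeZero d := ⟨hd.ne'⟩
  have h1 := h.pow_sub_pow_eq_prod_sub_mul 1 x hd
  rw [one_pow] at h1
  rw [h1]
  refine Finset.prod_nbij (fun j => η ^ j) ?_ ?_ ?_ (fun _ _ => rfl)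
  · intro j _
    rw [Polynomial.mem_nthRootsFinset hd, ← pow_mul, mul_comm, pow_mul, h.pow_eq_one, one_pow]
  · intro i hi j hj hij
    exact h.pow_inj (by simpa using hi) (by simpa using hj) hij
  · intro z hz
    obtain ⟨i, hi, rfl⟩ := h.eq_pow_of_pow_eq_one ((Polynomial.mem_nthRootsFinset hd _).mp (by simpa using hz))
    exact ⟨i, by simpa using hi, rfl⟩

theorem prod_primitive_mul {η : ℂ} {d : ℕ} (hd : 0 < d) (h : IsPrimitiveRoot η d) (x : ℂ) (k : ℕ) :
    ∏ j ∈ Finset.range (d * k), (1 - η ^ j * x) = (1 - x ^ d) ^ k := by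
  induction k with
  | zero => simp
  | succ k ih =>
    rw [mul_add, mul_one, Finset.prod_range_add, ih, pow_succ]
    congr 1
    rw [← prod_primitive hd h]
    refine Finset.prod_congr rfl fun j _ => ?_
    rw [pow_add, pow_mul, h.pow_eq_one, one_pow, one_mul]

theorem exists_gen (p : ℕ) [Fact p.Prime] (hodd : p ≠ 2) :
    ∃ ψ : DirichletCharacter ℂ p, (∀ a : (ZMod p)ˣ, orderOf (ψ a) = orderOf a) ∧ ψ (-1) = -1 ∧
      ∀ f : DirichletCharacter ℂ p → ℂ,
        ∏ χ, f χ = ∏ j ∈ Finset.range (p - 1), f (ψ ^ j) := by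
  classical
  have hp := (Fact.out : p.Prime)
  have hc : Fintype.card (ZMod p)ˣ = p - 1 := ZMod.card_units p
  obtain ⟨ψ, hψ⟩ := MulChar.exists_mulChar_orderOf_eq_card_units (ZMod p)
    (Complex.isPrimitiveRoot_exp (Fintype.card (ZMod p)ˣ) Fintype.card_ne_zero)
  rw [hc] at hψ
  have hcard : Nat.card (MulChar (ZMod p) ℂ) = p - 1 := by
    rw [MulChar.card_eq_card_units_of_hasEnoughRootsOfUnity, Nat.card_eq_fintype_card, hc]
  have hall : ∀ χ : DirichletCharacter ℂ p, ∃ j < p - 1, ψ ^ j = χ := by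
    intro χ
    have htop : Subgroup.zpowers ψ = ⊤ := by
      apply Subgroup.eq_top_of_card_eq
      rw [Nat.card_zpowers, hψ, hcard]
    have : χ ∈ Subgroup.zpowers ψ := by rw [htop]; trivial
    rw [mem_zpowers_iff_mem_range_orderOf, hψ] at this
    simpa using this
  have hfaith : ∀ a : ZMod p, ψ a = 1 → a = 1 := by
    intro a ha
    by_contra hne
    obtain ⟨χ, hχ⟩ := MulChar.exists_apply_ne_one_of_hasEnoughRootsOfUnity (ZMod p) ℂ hne
    obtain ⟨j, -, rfl⟩ := hall χ
    have hau : IsUnit a := by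
      by_contra h
      rw [MulChar.map_nonunit _ h] at ha
      exact zero_ne_one ha
    apply hχ
    obtain ⟨u, rfl⟩ := hau
    rw [MulChar.pow_apply_coe, ha, one_pow]
  refine ⟨ψ, fun a => ?_, ?_, ?_⟩
  · refine orderOf_eq_orderOf_iff.mpr fun n => ?_
    rw [← map_pow, ← Units.val_pow_eq_pow_val]
    constructor
    · intro h
      exact Units.ext (hfaith _ h)
    · intro h
      rw [h]; simp
  · have h1 : ψ (-1) * ψ (-1) = 1 := by rw [← map_mul]; simp
    rcases mul_self_eq_one_iff.mp h1 with h | h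
    · have := hfaith _ h
      have hp2 : 2 < p := by have := hp.two_le; omega
      have : Fact (2 < p) := ⟨hp2⟩
      exact absurd ‹(-1 : ZMod p) = 1› ZMod.neg_one_ne_one
    · exact h
  · intro f
    symm
    refine Finset.prod_nbij (fun j => ψ ^ j) (fun _ _ => Finset.mem_univ _) ?_ ?_ (fun _ _ => rfl)
    · intro i hi j hj hij
      exact pow_injOn_Iio_orderOf (by simpa [hψ] using hi) (by simpa [hψ] using hj) hij
    · intro χ _
      obtain ⟨j, hj, rfl⟩ := hall χ
      exact ⟨j, by simpa using hj, rfl⟩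

theorem char_prod (p : ℕ) [Fact p.Prime] (hodd : p ≠ 2) (a : (ZMod p)ˣ) (f f' g g' : ℕ)
    (hf : f = orderOf a) (hfg : f * g = p - 1) (hfg' : f' * g' = (p - 1) / 2)
    (hf' : (Odd f ∧ f' = f) ∨ f = 2 * f') (x : ℂ) :
    (∏ χ ∈ Finset.univ.filter (fun χ : DirichletCharacter ℂ p => χ (-1) = -1), (1 - χ a * x)) *
      (1 - x ^ f') ^ g' = (1 - x ^ f) ^ g := by
  classical
  have hp := (Fact.out : p.Prime)
  obtain ⟨ψ, h1, h2, h3⟩ := exists_gen p hodd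
  have hn : 2 * ((p - 1) / 2) = p - 1 := by
    have := hp.eq_two_or_odd'.resolve_left hodd
    obtain ⟨k, hk⟩ := this
    omega
  set n := (p - 1) / 2
  have hf0 : 0 < f := hf ▸ orderOf_pos a
  have hη : IsPrimitiveRoot (ψ a) f := by
    rw [hf, ← h1 a]; exact IsPrimitiveRoot.orderOf _
  have hf0' : 0 < f' := by rcases hf' with ⟨_, h⟩ | h <;> omega
  have hη' : IsPrimitiveRoot (ψ a ^ 2) f' := by
    rcases hf' with ⟨ho, rfl⟩ | h
    · exact hη.pow_of_coprime 2 (Nat.coprime_two_left.mpr ho)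
    · exact hη.pow (a := 2) (by omega) h
  have hall : (1 - x ^ f) ^ g = ∏ j ∈ Finset.range (2 * n), (1 - ψ a ^ j * x) := by
    rw [hn, ← hfg, prod_primitive_mul hf0 hη]
  have heven : (1 - x ^ f') ^ g' = ∏ j ∈ Finset.range n, (1 - (ψ a ^ 2) ^ j * x) := by
    rw [← hfg', prod_primitive_mul hf0' hη']
  rw [hall, heven]
  have hsplit : ∀ (u : ℕ → ℂ) (n : ℕ), ∏ j ∈ Finset.range (2 * n), u j =
      (∏ j ∈ Finset.range n, u (2 * j + 1)) * ∏ j ∈ Finset.range n, u (2 * j) := by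
    intro u n
    induction n with
    | zero => simp
    | succ n ih =>
      rw [show 2 * (n + 1) = 2 * n + 1 + 1 by ring, Finset.prod_range_succ, Finset.prod_range_succ, ih,
        Finset.prod_range_succ, Finset.prod_range_succ]
      ring
  rw [hsplit]
  congr 1
  · rw [Finset.prod_filter, h3, ← hn, hsplit]
    have hm : ∀ j, (ψ ^ j) (-1) = (-1) ^ j := by
      intro j
      have := MulChar.pow_apply_coe ψ j (-1 : (ZMod p)ˣ)
      simp only [Units.val_neg, Units.val_one] at this
      rw [this, h2]
    rw [← mul_one (∏ j ∈ Finset.range n, (1 - ψ a ^ (2 * j + 1) * x))]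
    congr 1
    · refine Finset.prod_congr rfl fun j _ => ?_
      rw [hm, if_pos (by simp [pow_succ, pow_mul]), MulChar.pow_apply_coe]
    · refine Finset.prod_eq_one fun j _ => ?_
      rw [hm, if_neg (by norm_num [pow_mul])]
  · refine Finset.prod_congr rfl fun j _ => ?_
    rw [pow_mul]
end Stmt16


namespace Stmt16
open Filter Topology NumberField

theorem local_count (K : Type*) [Field K] [NumberField K] (q : ℕ) (hq : q.Prime) (e f : ℕ)
    (h : ∀ P : Ideal (𝓞 K), P.IsPrime → P.LiesOver (Ideal.span {(q : ℤ)}) →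
      P.ramificationIdx ℤ = e ∧ P.inertiaDeg ℤ = f) :
    (IsDedekindDomain.primesOverFinset (Ideal.span {(q : ℤ)}) (𝓞 K)).card * (e * f) =
      Module.finrank ℚ K ∧ ∀ s : ℝ,
    ∏ P ∈ IsDedekindDomain.primesOverFinset (Ideal.span {(q : ℤ)}) (𝓞 K),
          (1 - (Ideal.absNorm P : ℝ) ^ (-s))⁻¹ = ((1 - ((q : ℝ) ^ (-s)) ^ f)⁻¹) ^
      (IsDedekindDomain.primesOverFinset (Ideal.span {(q : ℤ)}) (𝓞 K)).card := by
  classical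
  have := Fact.mk hq
  have hq0 : Ideal.span {(q : ℤ)} ≠ ⊥ := by simpa using hq.ne_zero
  have hmem : ∀ P : Ideal (𝓞 K),
      P ∈ IsDedekindDomain.primesOverFinset (Ideal.span {(q : ℤ)}) (𝓞 K) ↔
        P.IsPrime ∧ P.LiesOver (Ideal.span {(q : ℤ)}) := by
    intro P
    rw [IsDedekindDomain.mem_primesOverFinset_iff hq0]
    rfl
  constructor
  · have h1 := Ideal.sum_ramification_inertia (𝓞 K) ℚ K hq0
    rw [← h1, Finset.sum_congr rfl (g := fun _ => e * f)]
    · simp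
    · intro P hP
      rw [hmem] at hP
      obtain ⟨hP1, hP2⟩ := hP
      have hPm : P.IsMaximal := hP1.isMaximal (Ideal.ne_bot_of_liesOver_of_ne_bot hq0 P)
      rw [Ideal.inertiaDeg'_eq_inertiaDeg, Ideal.ramificationIdx'_eq_ramificationIdx _ _ hq0, (h P hP1 hP2).1, (h P hP1 hP2).2]
  · intro s
    rw [Finset.prod_congr rfl (g := fun _ => (1 - ((q : ℝ) ^ (-s)) ^ f)⁻¹)]
    · simp
    · intro P hP
      rw [hmem] at hP
      obtain ⟨hP1, hP2⟩ := hP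
      have hPm : P.IsMaximal := hP1.isMaximal (Ideal.ne_bot_of_liesOver_of_ne_bot hq0 P)
      rw [← Ideal.pow_inertiaDeg q, (h P hP1 hP2).2, Nat.cast_pow, ← Real.rpow_natCast_mul (by positivity),
        ← Real.rpow_mul_natCast (by positivity), mul_comm]

open NumberField.IsCMField in
theorem conj_zeta {p : ℕ} [NeZero p] (K : Type*) [Field K] [NumberField K] [IsCMField K] {ζ : K}
    (hζ : IsPrimitiveRoot ζ p) :
    ringOfIntegersComplexConj K hζ.toInteger * hζ.toInteger = 1 := by
  have h1 : hζ.toInteger ^ p = 1 := hζ.toInteger_isPrimitiveRoot.pow_eq_one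
  let u : (𝓞 K)ˣ := Units.ofPowEqOne _ p h1 (NeZero.ne p)
  have hu : u ∈ Units.torsion K := by
    refine isOfFinOrder_iff_pow_eq_one.mpr ⟨p, Nat.pos_of_ne_zero (NeZero.ne p), Units.ext (by simpa [u] using h1)⟩
  have h2 := complexConj_torsion K ⟨u, hu⟩
  apply RingOfIntegers.ext
  have h3 : ((u : 𝓞 K) : K) = ζ := rfl
  simp only [h3] at h2
  change complexConj K ζ * ζ = 1
  rw [h2, inv_mul_cancel₀ (hζ.ne_zero (NeZero.ne p))]

section
variable (p : ℕ) [Fact p.Prime] (K : Type*) [Field K] [NumberField K]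
  [IsCyclotomicExtension {p} ℚ K] [IsCMField K]

open NumberField.IsCMField in
theorem frob_conj (q : ℕ) [Fact q.Prime] (k : ℕ) (hk : ((q : ZMod p)) ^ k = -1)
    (P : Ideal (𝓞 K)) [P.IsPrime] [P.LiesOver (Ideal.span {(q : ℤ)})] (x : 𝓞 K) :
    Ideal.Quotient.mk P x ^ (q ^ k) = Ideal.Quotient.mk P (ringOfIntegersComplexConj K x) := by
  have hζ := IsCyclotomicExtension.zeta_spec p ℚ K
  have hchar : CharP (𝓞 K ⧸ P) q := by
    have := Ideal.ringChar_quot P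
    rw [← Ideal.over_def P (Ideal.span {(q : ℤ)})] at this
    simp at this
    exact ringChar.of_eq this
  let φ₁ : 𝓞 K →ₐ[ℤ] 𝓞 K ⧸ P := ((iterateFrobenius (𝓞 K ⧸ P) q k).comp (Ideal.Quotient.mk P)).toIntAlgHom
  let φ₂ : 𝓞 K →ₐ[ℤ] 𝓞 K ⧸ P := ((Ideal.Quotient.mk P).comp
    (ringOfIntegersComplexConj K : 𝓞 K →+* 𝓞 K)).toIntAlgHom
  have : φ₁ = φ₂ := by
    refine AlgHom.ext_of_adjoin_eq_top (IsCyclotomicExtension.Rat.adjoin_singleton_eq_top hζ) ?_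
    rintro y rfl
    change Ideal.Quotient.mk P hζ.toInteger ^ (q ^ k) = Ideal.Quotient.mk P (ringOfIntegersComplexConj K hζ.toInteger)
    rw [← map_pow]
    congr 1
    have hc := conj_zeta K hζ
    have h1 : hζ.toInteger ^ p = 1 := hζ.toInteger_isPrimitiveRoot.pow_eq_one
    have h2 : hζ.toInteger ^ (q ^ k) * hζ.toInteger = 1 := by
      rw [← pow_succ]
      have : p ∣ q ^ k + 1 := by
        rw [← ZMod.natCast_eq_zero_iff]
        push_cast
        rw [hk]; ring
      obtain ⟨c, hc⟩ := this
      rw [hc, pow_mul, h1, one_pow]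
    calc hζ.toInteger ^ (q ^ k) = hζ.toInteger ^ (q ^ k) * (ringOfIntegersComplexConj K hζ.toInteger * hζ.toInteger) := by
          rw [hc, mul_one]
      _ = (hζ.toInteger ^ (q ^ k) * hζ.toInteger) * ringOfIntegersComplexConj K hζ.toInteger := by ring
      _ = _ := by rw [h2, one_mul]
  exact DFunLike.congr_fun this x

end
end Stmt16


namespace Stmt16
open Filter Topology NumberField

set_option linter.unusedSectionVars false
set_option linter.style.haveILetI false
section
variable (p : ℕ) [Fact p.Prime] (K : Type*) [Field K] [NumberField K]
  [IsCyclotomicExtension {p} ℚ K] [IsCMField K]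

theorem finrank_K : Module.finrank ℚ K = p - 1 := by
  rw [IsCyclotomicExtension.Rat.finrank p K, Nat.totient_prime Fact.out]

theorem finrank_F : Module.finrank ℚ (maximalRealSubfield K) * 2 = p - 1 := by
  rw [← finrank_K p K, ← Module.finrank_mul_finrank ℚ (maximalRealSubfield K) K,
    Algebra.IsQuadraticExtension.finrank_eq_two (maximalRealSubfield K) K]

theorem above_le_two (P : Ideal (𝓞 K)) [P.IsPrime] (P' : Ideal (𝓞 (maximalRealSubfield K)))
    [P'.IsPrime] [P.LiesOver P'] (h0 : P' ≠ ⊥) :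
    P.inertiaDeg (𝓞 (maximalRealSubfield K)) ≤ 2 ∧
      P.ramificationIdx (𝓞 (maximalRealSubfield K)) ≤ 2 := by
  have : P'.IsMaximal := Ideal.IsPrime.isMaximal ‹_› h0
  have : P.IsMaximal := Ideal.IsPrime.isMaximal ‹_› (Ideal.ne_bot_of_liesOver_of_ne_bot h0 P)
  have h2 := Algebra.IsQuadraticExtension.finrank_eq_two (maximalRealSubfield K) K
  rw [← Ideal.inertiaDeg'_eq_inertiaDeg P', ← Ideal.ramificationIdx'_eq_ramificationIdx P' _ h0, ← h2]
  have hnz : NoZeroSMulDivisors (𝓞 (maximalRealSubfield K)) (𝓞 K) := ⟨fun {c x} h => by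
    rw [Algebra.smul_def, mul_eq_zero] at h
    refine h.imp_left fun h => ?_
    exact (FaithfulSMul.algebraMap_injective (𝓞 (maximalRealSubfield K)) (𝓞 K)) (by rw [h, map_zero])⟩
  exact ⟨Ideal.inertiaDeg_le_finrank _ _ K P h0, Ideal.ramificationIdx_le_finrank _ _ K P⟩

theorem exists_above (P' : Ideal (𝓞 (maximalRealSubfield K))) [P'.IsPrime] (q : ℕ) [P'.LiesOver (Ideal.span {(q : ℤ)})] :
    ∃ P : Ideal (𝓞 K), P.IsPrime ∧ P.LiesOver P' ∧ P.LiesOver (Ideal.span {(q : ℤ)}) := by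
  obtain ⟨⟨P, h1, h2⟩⟩ := P'.nonempty_primesOver (S := 𝓞 K)
  exact ⟨P, h1, h2, Ideal.LiesOver.trans P P' (Ideal.span {(q : ℤ)})⟩

open NumberField.IsCMField in
theorem F_inert_le (q : ℕ) [Fact q.Prime] (k : ℕ) (hk : ((q : ZMod p)) ^ k = -1)
    (P' : Ideal (𝓞 (maximalRealSubfield K))) [P'.IsPrime] [P'.LiesOver (Ideal.span {(q : ℤ)})]
    (hk0 : k ≠ 0) :
    P'.inertiaDeg ℤ ≤ k := by
  obtain ⟨P, h1, h2, h3⟩ := exists_above K P' q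
  have hq := Fact.out (p := q.Prime)
  have hq0 : Ideal.span {(q : ℤ)} ≠ ⊥ := by simpa using hq.ne_zero
  have hP0 : P' ≠ ⊥ := Ideal.ne_bot_of_liesOver_of_ne_bot hq0 P'
  have : P'.IsMaximal := Ideal.IsPrime.isMaximal ‹_› hP0
  have hfin : Finite (𝓞 (maximalRealSubfield K) ⧸ P') := Ideal.finiteQuotientOfFreeOfNeBot P' hP0
  letI := Ideal.Quotient.field P'
  have hpow : ∀ y : 𝓞 (maximalRealSubfield K) ⧸ P', y ^ (q ^ k) = y := by
    intro y
    obtain ⟨x, rfl⟩ := Ideal.Quotient.mk_surjective y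
    have h := frob_conj p K q k hk P (algebraMap _ _ x)
    have hx : ringOfIntegersComplexConj K (algebraMap (𝓞 (maximalRealSubfield K)) (𝓞 K) x) = algebraMap _ _ x := by
      rw [ringOfIntegersComplexConj_eq_self_iff]
      exact ⟨x, rfl⟩
    rw [hx, ← map_pow, ← map_pow, Ideal.Quotient.eq, ← map_sub] at h
    rw [← map_pow, Ideal.Quotient.eq, Ideal.over_def P P']
    exact h
  have hcard : Nat.card (𝓞 (maximalRealSubfield K) ⧸ P') = q ^ P'.inertiaDeg ℤ := by
    rw [Ideal.pow_inertiaDeg q P']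
    rfl
  letI := Fintype.ofFinite (𝓞 (maximalRealSubfield K) ⧸ P')
  have hle : Nat.card (𝓞 (maximalRealSubfield K) ⧸ P') ≤ q ^ k := by
    have hne : q ^ k ≠ 1 := by
      intro h; rw [Nat.pow_eq_one] at h; exact h.elim hq.one_lt.ne' hk0
    have h1q : 1 < q ^ k := Nat.one_lt_pow hk0 hq.one_lt
    have h0 := FiniteField.X_pow_card_sub_X_ne_zero (𝓞 (maximalRealSubfield K) ⧸ P') h1q
    rw [Nat.card_eq_fintype_card, ← Finset.card_univ]
    have hd := FiniteField.X_pow_card_sub_X_natDegree_eq (𝓞 (maximalRealSubfield K) ⧸ P') h1q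
    rw [← hd]
    refine Polynomial.card_le_degree_of_subset_roots (p := Polynomial.X ^ (q ^ k) - Polynomial.X) ?_
    intro y _
    rw [Polynomial.mem_roots h0]
    simp [hpow y]
  rw [hcard] at hle
  exact (Nat.pow_le_pow_iff_right hq.one_lt).mp hle

theorem F_local_ne (q : ℕ) [Fact q.Prime] (hqp : ¬ q ∣ p) (f f' : ℕ) (hf : f = orderOf (q : ZMod p))
   (hf' : (Odd f ∧ f' = f) ∨ (f = 2 * f' ∧ (q : ZMod p) ^ f' = -1 ∧ f' ≠ 0))
    (P' : Ideal (𝓞 (maximalRealSubfield K))) [P'.IsPrime] [P'.LiesOver (Ideal.span {(q : ℤ)})] :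
    P'.ramificationIdx ℤ = 1 ∧ P'.inertiaDeg ℤ = f' := by
  obtain ⟨P, h1, h2, h3⟩ := exists_above K P' q
  have hq := Fact.out (p := q.Prime)
  have hq0 : Ideal.span {(q : ℤ)} ≠ ⊥ := by simpa using hq.ne_zero
  have hP0 : P' ≠ ⊥ := Ideal.ne_bot_of_liesOver_of_ne_bot hq0 P'
  have hr := IsCyclotomicExtension.Rat.ramificationIdx_eq_of_not_dvd q K P hqp
  have hi := IsCyclotomicExtension.Rat.inertiaDeg_eq_of_not_dvd q K P hqp
  rw [Ideal.ramificationIdx_tower P' P] at hr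
  rw [Ideal.inertiaDeg_tower P' P, ← hf] at hi
  refine ⟨Nat.eq_one_of_mul_eq_one_right hr, ?_⟩
  have hle := (above_le_two K P P' hP0).1
  generalize P.inertiaDeg (𝓞 (maximalRealSubfield K)) = j at *
  rcases hf' with ⟨ho, rfl⟩ | ⟨h2, hk, hk0⟩
  · interval_cases j
    · simp at hi; subst hi; simp at ho
    · simpa using hi
    · rw [← hi] at ho; exact absurd ho (by simp)
  · have := F_inert_le p K q f' hk P' hk0
    have : P'.inertiaDeg ℤ * j ≤ P'.inertiaDeg ℤ * 2 := Nat.mul_le_mul_left _ hle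
    omega

theorem F_local_p (P' : Ideal (𝓞 (maximalRealSubfield K))) [P'.IsPrime] [P'.LiesOver (Ideal.span {(p : ℤ)})] :
    P'.ramificationIdx ℤ = (p - 1) / 2 ∧ P'.inertiaDeg ℤ = 1 := by
  obtain ⟨P, h1, h2, h3⟩ := exists_above K P' p
  have hq := Fact.out (p := p.Prime)
  have hq0 : Ideal.span {(p : ℤ)} ≠ ⊥ := by simpa using hq.ne_zero
  have hP0 : P' ≠ ⊥ := Ideal.ne_bot_of_liesOver_of_ne_bot hq0 P'
  have hr := IsCyclotomicExtension.Rat.ramificationIdx_eq_of_prime p K P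
  have hi := IsCyclotomicExtension.Rat.inertiaDeg_eq_of_prime p K P
  rw [Ideal.ramificationIdx_tower P' P] at hr
  rw [Ideal.inertiaDeg_tower P' P] at hi
  refine ⟨?_, Nat.eq_one_of_mul_eq_one_right hi⟩
  have hle := (above_le_two K P P' hP0).2
  have hle2 := Ideal.ramificationIdx_le_finrank (p := Ideal.span {(p : ℤ)}) _ ℚ (maximalRealSubfield K) P'
  rw [Ideal.ramificationIdx'_eq_ramificationIdx _ _ hq0] at hle2
  have := finrank_F p K
  have : P'.ramificationIdx ℤ * P.ramificationIdx (𝓞 (maximalRealSubfield K)) ≤ P'.ramificationIdx ℤ * 2 := Nat.mul_le_mul_left _ hle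
  omega
end
end Stmt16


namespace Stmt16
open Filter Topology NumberField

section
variable (p : ℕ) [Fact p.Prime] (K : Type*) [Field K] [NumberField K]
  [IsCyclotomicExtension {p} ℚ K] [IsCMField K]

theorem local_identity (hodd : p ≠ 2) (q : ℕ) (hq : q.Prime) (s : ℝ) :
    ((∏ P ∈ IsDedekindDomain.primesOverFinset (Ideal.span {(q : ℤ)}) (𝓞 K),
          (1 - (Ideal.absNorm P : ℝ) ^ (-s))⁻¹ : ℝ) : ℂ) =
    ((∏ P ∈ IsDedekindDomain.primesOverFinset (Ideal.span {(q : ℤ)}) (𝓞 (maximalRealSubfield K)),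
          (1 - (Ideal.absNorm P : ℝ) ^ (-s))⁻¹ : ℝ) : ℂ) *
    ∏ χ ∈ Finset.univ.filter (fun χ : DirichletCharacter ℂ p => χ (-1) = -1),
      (1 - χ q * (q : ℂ) ^ (-(s : ℂ)))⁻¹ := by
  have hqf := Fact.mk hq
  have hp := Fact.out (p := p.Prime)
  have hx : (q : ℂ) ^ (-(s : ℂ)) = (((q : ℝ) ^ (-s) : ℝ) : ℂ) := by
    rw [Complex.ofReal_cpow (by positivity)]; push_cast; rfl
  rw [hx]
  have hFr := finrank_F p K
  have hKr := finrank_K p K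
  by_cases hqp : q = p
  · subst hqp
    obtain ⟨k1, k2⟩ := local_count K q hq (q - 1) 1 fun P _ _ =>
      ⟨IsCyclotomicExtension.Rat.ramificationIdx_eq_of_prime q K P,
        IsCyclotomicExtension.Rat.inertiaDeg_eq_of_prime q K P⟩
    obtain ⟨f1, f2⟩ := local_count (maximalRealSubfield K) q hq ((q - 1) / 2) 1 fun P _ _ =>
      F_local_p q K P
    have h3 : 2 < q := lt_of_le_of_ne hq.two_le (Ne.symm hodd)
    rw [k2, f2]
    have c1 : (IsDedekindDomain.primesOverFinset (Ideal.span {(q : ℤ)}) (𝓞 K)).card = 1 := by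
      rw [hKr, mul_one] at k1
      exact Nat.eq_of_mul_eq_mul_right (show 0 < q - 1 by omega) (by rw [k1, one_mul])
    have c2 : (IsDedekindDomain.primesOverFinset (Ideal.span {(q : ℤ)}) (𝓞 (maximalRealSubfield K))).card = 1 := by
      have hh : Module.finrank ℚ (maximalRealSubfield K) = (q - 1) / 2 := by omega
      rw [hh, mul_one] at f1
      exact Nat.eq_of_mul_eq_mul_right (show 0 < (q - 1) / 2 by omega) (by rw [f1, one_mul])
    rw [c1, c2]
    have hz : ∀ χ : DirichletCharacter ℂ q, χ (q : ZMod q) = 0 := fun χ => by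
      rw [ZMod.natCast_self]; exact MulChar.map_zero χ
    simp only [hz]
    simp
  · have hnd : ¬ q ∣ p := fun h => hqp ((Nat.prime_dvd_prime_iff_eq hq hp).mp h)
    have hcop : Nat.Coprime q p := (Nat.coprime_primes hq hp).mpr hqp
    let a : (ZMod p)ˣ := ZMod.unitOfCoprime q hcop
    have ha : (a : ZMod p) = q := rfl
    have hao : orderOf a = orderOf (q : ZMod p) := by rw [← ha, orderOf_units]
    have hpos : 0 < orderOf (q : ZMod p) := by rw [← hao]; exact orderOf_pos a
    have hex : ∃ f', (Odd (orderOf (q : ZMod p)) ∧ f' = orderOf (q : ZMod p)) ∨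
        (orderOf (q : ZMod p) = 2 * f' ∧ (q : ZMod p) ^ f' = -1 ∧ f' ≠ 0) := by
      rcases Nat.even_or_odd' (orderOf (q : ZMod p)) with ⟨k, hk | hk⟩
      · refine ⟨k, Or.inr ⟨hk, ?_, by omega⟩⟩
        have h1 : ((q : ZMod p) ^ k) ^ 2 = 1 := by
          rw [← pow_mul, mul_comm, ← hk, pow_orderOf_eq_one]
        rcases eq_or_eq_neg_of_sq_eq_sq _ _ (h1.trans (one_pow 2).symm) with h | h
        · exfalso
          have := orderOf_dvd_of_pow_eq_one h
          have := Nat.le_of_dvd (by omega) this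
          omega
        · exact h
      · exact ⟨_, Or.inl ⟨⟨k, hk⟩, rfl⟩⟩
    obtain ⟨f', hf'⟩ := hex
    obtain ⟨k1, k2⟩ := local_count K q hq 1 (orderOf (q : ZMod p)) fun P _ _ =>
      ⟨IsCyclotomicExtension.Rat.ramificationIdx_eq_of_not_dvd q K P hnd,
        IsCyclotomicExtension.Rat.inertiaDeg_eq_of_not_dvd q K P hnd⟩
    obtain ⟨f1, f2⟩ := local_count (maximalRealSubfield K) q hq 1 f' fun P _ _ =>
      F_local_ne p K q hnd _ f' rfl hf' P
    have hh : Module.finrank ℚ (maximalRealSubfield K) = (p - 1) / 2 := by omega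
    rw [hKr, one_mul, mul_comm] at k1
    rw [hh, one_mul, mul_comm] at f1
    have key := char_prod p hodd a _ f' _ _ hao.symm k1 f1
      (hf'.imp id fun h => h.1) (((q : ℝ) ^ (-s) : ℝ) : ℂ)
    rw [k2, f2]
    push_cast at key ⊢
    rw [Finset.prod_inv_distrib, inv_pow, inv_pow, ← mul_inv, ← key, mul_comm]
    rfl

theorem zeta_factor (hodd : p ≠ 2) (s : ℝ) (hs : 1 < s) :
    dedekindZeta K s = dedekindZeta (maximalRealSubfield K) s *
    ∏ χ ∈ Finset.univ.filter (fun χ : DirichletCharacter ℂ p => χ (-1) = -1),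
      DirichletCharacter.LFunction χ s := by
  obtain ⟨Z, hZ, tZ⟩ := euler_zeta K s hs
  obtain ⟨Y, hY, tY⟩ := euler_zeta (maximalRealSubfield K) s hs
  rw [hZ, hY]
  have hs' : 1 < (s : ℂ).re := by simpa using hs
  have tL : Tendsto (fun N : ℕ => ∏ χ ∈ Finset.univ.filter (fun χ : DirichletCharacter ℂ p => χ (-1) = -1),
      ∏ q ∈ Nat.primesBelow N, (1 - χ q * (q : ℂ) ^ (-(s : ℂ)))⁻¹) atTop
      (𝓝 (∏ χ ∈ Finset.univ.filter (fun χ : DirichletCharacter ℂ p => χ (-1) = -1),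
      DirichletCharacter.LFunction χ s)) := by
    refine tendsto_finsetProd _ fun χ _ => ?_
    rw [DirichletCharacter.LFunction_eq_LSeries χ hs']
    exact DirichletCharacter.LSeries_eulerProduct χ hs'
  have tZ' := (Complex.continuous_ofReal.tendsto _).comp tZ
  have tY' := ((Complex.continuous_ofReal.tendsto _).comp tY).mul tL
  refine tendsto_nhds_unique tZ' (tY'.congr fun N => ?_)
  simp only [Function.comp_apply]
  rw [Finset.prod_comm, Complex.ofReal_prod, Complex.ofReal_prod, ← Finset.prod_mul_distrib]
  refine Finset.prod_congr rfl fun q hq => ?_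
  exact (local_identity p K hodd q (Nat.prime_of_mem_primesBelow hq) s).symm

theorem residue_factor (hodd : p ≠ 2) :
    (dedekindZeta_residue K : ℂ) = dedekindZeta_residue (maximalRealSubfield K) *
    ∏ χ ∈ Finset.univ.filter (fun χ : DirichletCharacter ℂ p => χ (-1) = -1),
      DirichletCharacter.LFunction χ 1 := by
  have t1 := tendsto_sub_one_mul_dedekindZeta_nhdsGT K
  have t2 := tendsto_sub_one_mul_dedekindZeta_nhdsGT (maximalRealSubfield K)
  have tL : Tendsto (fun s : ℝ => ∏ χ ∈ Finset.univ.filter (fun χ : DirichletCharacter ℂ p => χ (-1) = -1),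
      DirichletCharacter.LFunction χ s) (𝓝[>] 1)
      (𝓝 (∏ χ ∈ Finset.univ.filter (fun χ : DirichletCharacter ℂ p => χ (-1) = -1),
      DirichletCharacter.LFunction χ 1)) := by
    refine tendsto_finsetProd _ fun χ hχ => ?_
    have hne : χ ≠ 1 := by
      rintro rfl
      have h := (Finset.mem_filter.mp hχ).2
      rw [MulChar.one_apply (by simp)] at h
      norm_num at h
    have hc := (DirichletCharacter.differentiable_LFunction hne).continuous.comp Complex.continuous_ofReal
    have := hc.tendsto 1
    simp only [Function.comp_apply, Complex.ofReal_one] at this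
    exact this.mono_left nhdsWithin_le_nhds
  refine tendsto_nhds_unique t1 ((t2.mul tL).congr' ?_)
  filter_upwards [self_mem_nhdsWithin] with s hs
  rw [zeta_factor p K hodd s hs, mul_assoc]
end
end Stmt16


namespace Stmt16
open Filter Topology NumberField

theorem torsion_real (F : Type*) [Field F] [NumberField F] [IsTotallyReal F] :
    Units.torsionOrder F = 2 := by
  classical
  let := Fintype.ofFinite (Units.torsion F)
  rw [Units.torsionOrder, Nat.card_eq_fintype_card]
  refine (Finset.card_eq_two.2 ⟨1, ⟨-1, neg_one_mem_torsion⟩,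
    by simp [← Subtype.coe_ne_coe], Finset.ext fun x ↦ ⟨fun _ ↦ ?_, fun _ ↦ Finset.mem_univ _⟩⟩)
  rw [Finset.mem_insert, Finset.mem_singleton, ← Subtype.val_inj, ← Subtype.val_inj]
  obtain ⟨u, hu⟩ := x
  have hφ : Nonempty (F →+* ℂ) := inferInstance
  obtain ⟨φ⟩ := hφ
  have hr := IsTotallyReal.complexEmbedding_isReal (K := F) φ
  let ψ : F →+* ℝ := hr.embedding
  obtain ⟨n, hn, hn1⟩ := isOfFinOrder_iff_pow_eq_one.mp (show IsOfFinOrder u from hu)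
  have h1 : (ψ ((u : 𝓞 F) : F)) ^ n = 1 := by
    rw [← map_pow]
    have : (((u ^ n : (𝓞 F)ˣ) : 𝓞 F) : F) = 1 := by rw [hn1]; simp
    rw [show ((u : 𝓞 F) : F) ^ n = 1 by simpa using this, map_one]
  have h2 : |ψ ((u : 𝓞 F) : F)| = 1 := by
    have : |ψ ((u : 𝓞 F) : F)| ^ n = 1 := by rw [← abs_pow, h1, abs_one]
    exact (pow_eq_one_iff_of_nonneg (abs_nonneg _) hn.ne').mp this
  rcases eq_or_eq_neg_of_abs_eq h2 with h | h
  · left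
    apply Units.coe_injective
    apply ψ.injective
    simpa using h
  · right
    apply Units.coe_injective
    apply ψ.injective
    simpa using h

theorem adjoin_top_tower (R S A : Type*) [CommRing R] [CommRing S] [CommRing A] [Algebra R S]
    [Algebra R A] [Algebra S A] [IsScalarTower R S A] {s : Set A}
    (h : Algebra.adjoin R s = ⊤) : Algebra.adjoin S s = ⊤ := by
  have hle : Algebra.adjoin R s ≤ (Algebra.adjoin S s).restrictScalars R := by
    apply Algebra.adjoin_le
    rw [Subalgebra.coe_restrictScalars]
    exact Algebra.subset_adjoin
  rw [h] at hle
  rw [Algebra.eq_top_iff]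
  intro x
  exact (Subalgebra.mem_restrictScalars R).mp (hle Algebra.mem_top)

section
variable (p : ℕ) [Fact p.Prime] (K : Type*) [Field K] [NumberField K]
  [IsCyclotomicExtension {p} ℚ K] [IsCMField K]

open NumberField.IsCMField in
theorem conj_mod {ζ : K} (hζ : IsPrimitiveRoot ζ p) (x : 𝓞 K) :
    ringOfIntegersComplexConj K x - x ∈ Ideal.span {hζ.toInteger - 1} := by
  set P := Ideal.span {hζ.toInteger - 1}
  let φ₁ : 𝓞 K →ₐ[ℤ] 𝓞 K ⧸ P := (Ideal.Quotient.mk P).toIntAlgHom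
  let φ₂ : 𝓞 K →ₐ[ℤ] 𝓞 K ⧸ P := ((Ideal.Quotient.mk P).comp
    (ringOfIntegersComplexConj K : 𝓞 K →+* 𝓞 K)).toIntAlgHom
  have : φ₂ = φ₁ := by
    refine AlgHom.ext_of_adjoin_eq_top (IsCyclotomicExtension.Rat.adjoin_singleton_eq_top hζ) ?_
    rintro y rfl
    change Ideal.Quotient.mk P (ringOfIntegersComplexConj K hζ.toInteger) = Ideal.Quotient.mk P hζ.toInteger
    have hc := conj_zeta K hζ
    have hone : Ideal.Quotient.mk P hζ.toInteger = 1 := by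
      rw [← map_one (Ideal.Quotient.mk P), Ideal.Quotient.eq]
      exact Ideal.mem_span_singleton_self _
    have := congrArg (Ideal.Quotient.mk P) hc
    rw [map_mul, hone, mul_one, map_one] at this
    rw [this, hone]
  rw [← Ideal.Quotient.eq]
  exact DFunLike.congr_fun this x

open NumberField.IsCMField in
theorem index_one (hp2 : 2 < p) : indexRealUnits K = 1 := by
  rcases indexRealUnits_eq_one_or_two K with h | h
  · exact h
  exfalso
  rw [indexRealUnits_eq_two_iff] at h
  obtain ⟨u, hu⟩ := h
  have hζ := IsCyclotomicExtension.zeta_spec p ℚ K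
  set P := Ideal.span {hζ.toInteger - 1} with hP
  let m : (𝓞 K)ˣ →* (𝓞 K ⧸ P)ˣ := Units.map (Ideal.Quotient.mk P).toMonoidHom
  have hm : m (unitsMulComplexConjInv K u) = 1 := by
    rw [unitsMulComplexConjInv_apply, map_mul, map_inv, mul_inv_eq_one]
    apply Units.ext
    change Ideal.Quotient.mk P (u : 𝓞 K) = Ideal.Quotient.mk P (ringOfIntegersComplexConj K (u : 𝓞 K))
    symm
    rw [Ideal.Quotient.eq]
    exact conj_mod p K hζ _
  have hmem : (⟨-1, neg_one_mem_torsion⟩ : Units.torsion K) ∈ Subgroup.zpowers (unitsMulComplexConjInv K u) := by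
    rw [hu]; trivial
  obtain ⟨n, hn⟩ := hmem
  have h1 : m (-1) = 1 := by
    have := congrArg (fun t : Units.torsion K => m t) hn
    simp only [SubgroupClass.coe_zpow, map_zpow, hm, one_zpow] at this
    exact this.symm
  have h2 := congrArg Units.val h1
  change Ideal.Quotient.mk P (-1) = 1 at h2
  rw [← map_one (Ideal.Quotient.mk P), Ideal.Quotient.eq] at h2
  apply IsCyclotomicExtension.Rat.two_not_mem_span_zeta_sub_one' p hζ hp2
  have := neg_mem h2
  convert this using 1
  norm_num

open NumberField.IsCMField Polynomial in
theorem differ_F (hp2 : 2 < p) :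
    Ideal.absNorm (differentIdeal (𝓞 (maximalRealSubfield K)) (𝓞 K)) = p := by
  have hζ := IsCyclotomicExtension.zeta_spec p ℚ K
  set z := hζ.toInteger with hz
  set zb := ringOfIntegersComplexConj K z with hzb
  have hc : zb * z = 1 := conj_zeta K hζ
  have hbb : ringOfIntegersComplexConj K zb = z := by
    apply RingOfIntegers.ext
    exact complexConj_apply_apply K _
  obtain ⟨a, ha⟩ : ∃ a : 𝓞 (maximalRealSubfield K), algebraMap _ (𝓞 K) a = z + zb := by
    have : ringOfIntegersComplexConj K (z + zb) = z + zb := by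
      rw [map_add, hbb, ← hzb, add_comm]
    rw [ringOfIntegersComplexConj_eq_self_iff] at this
    exact this
  have hmin : minpoly (𝓞 (maximalRealSubfield K)) z = X ^ 2 - C a * X + 1 := by
    have hIntg : IsIntegral (𝓞 (maximalRealSubfield K)) z := IsIntegralClosure.isIntegral _ K z
    have hdeg : (X ^ 2 - C a * X + 1 : (𝓞 (maximalRealSubfield K))[X]).natDegree = 2 := by
      compute_degree!
    have hmon : (X ^ 2 - C a * X + 1 : (𝓞 (maximalRealSubfield K))[X]).Monic := by
      rw [Polynomial.Monic.def, Polynomial.leadingCoeff, hdeg]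
      simp [coeff_one, coeff_X]
    have hev : aeval z (X ^ 2 - C a * X + 1 : (𝓞 (maximalRealSubfield K))[X]) = 0 := by
      simp only [map_add, map_sub, map_mul, map_pow, aeval_X, aeval_C, map_one, ha]
      linear_combination -hc
    have hdvd := minpoly.isIntegrallyClosed_dvd hIntg hev
    symm
    refine Polynomial.eq_of_dvd_of_natDegree_le_of_leadingCoeff hdvd ?_ ?_ |>.symm
    · rw [hdeg, minpoly.two_le_natDegree_iff hIntg]
      rintro ⟨b, hb⟩
      have h1 : ringOfIntegersComplexConj K z = z := by
        rw [ringOfIntegersComplexConj_eq_self_iff]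
        exact ⟨b, hb⟩
      rw [← hzb] at h1
      rw [h1, ← sq] at hc
      have := hζ.toInteger_isPrimitiveRoot.dvd_of_pow_eq_one 2 hc
      have := Nat.le_of_dvd (by norm_num) this
      omega
    · rw [(minpoly.monic hIntg).leadingCoeff, hmon.leadingCoeff]
  have hadjK : Algebra.adjoin (maximalRealSubfield K) {algebraMap (𝓞 K) K z} = ⊤ :=
    adjoin_top_tower ℚ (maximalRealSubfield K) K
      (IsCyclotomicExtension.adjoin_primitive_root_eq_top (A := ℚ) hζ)
  have hadjO : Algebra.adjoin (𝓞 (maximalRealSubfield K)) {z} = ⊤ :=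
    adjoin_top_tower ℤ (𝓞 (maximalRealSubfield K)) (𝓞 K)
      (IsCyclotomicExtension.Rat.adjoin_singleton_eq_top hζ)
  have key := conductor_mul_differentIdeal (𝓞 (maximalRealSubfield K)) (maximalRealSubfield K) K z hadjK
  rw [conductor_eq_top_of_adjoin_eq_top hadjO, Ideal.top_mul, hmin] at key
  rw [key]
  have hder : aeval z (derivative (X ^ 2 - C a * X + 1 : (𝓞 (maximalRealSubfield K))[X])) = z - zb := by
    simp [ha]; ring
  rw [hder]
  have hcop : Nat.Coprime 2 p := by
    rw [Nat.coprime_primes Nat.prime_two Fact.out]; omega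
  have hass := hζ.toInteger_isPrimitiveRoot.associated_sub_one_pow_sub_one_of_coprime hcop
  have hass2 : Associated (z - 1) (z - zb) := by
    refine hass.trans ⟨⟨zb, z, hc, by rw [mul_comm, hc]⟩, ?_⟩
    simp only
    linear_combination (z : 𝓞 K) * hc
  rw [← Ideal.span_singleton_eq_span_singleton.mpr hass2]
  have h1 : IsCyclotomicExtension {p ^ (0 + 1)} ℚ K := by simpa using ‹IsCyclotomicExtension {p} ℚ K›
  have h2 : IsPrimitiveRoot (IsCyclotomicExtension.zeta p ℚ K) (p ^ (0 + 1)) := by simpa using hζ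
  exact IsCyclotomicExtension.Rat.absNorm_span_zeta_sub_one p 0 h2

theorem discr_K : (discr K).natAbs = p ^ (p - 2) := by
  rw [IsCyclotomicExtension.Rat.discr_prime p K, Int.natAbs_mul, Int.natAbs_pow]
  simp [Int.natAbs_pow]

theorem discr_F (hp2 : 2 < p) : (discr (maximalRealSubfield K)).natAbs = p ^ ((p - 3) / 2) := by
  have h := natAbs_discr_eq_absNorm_differentIdeal_mul_natAbs_discr_pow (maximalRealSubfield K)
    (𝓞 (maximalRealSubfield K)) K (𝓞 K)
  rw [differ_F p K hp2, discr_K p K, Algebra.IsQuadraticExtension.finrank_eq_two] at h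
  have ho : p % 2 = 1 := Nat.odd_iff.mp ((Fact.out : p.Prime).odd_of_ne_two (by omega))
  have he : p - 2 = 1 + (p - 3) / 2 * 2 := by omega
  rw [he, pow_add, pow_one, pow_mul] at h
  have := Nat.eq_of_mul_eq_mul_left (by omega) h
  exact (Nat.pow_left_injective (by norm_num : 2 ≠ 0) this).symm
end
end Stmt16


namespace Stmt16
open Filter Topology NumberField

theorem L_prod (p : ℕ) [Fact p.Prime] (K : Type*) [Field K] [NumberField K]
    [IsCyclotomicExtension {p} ℚ K] [IsCMField K] (hp2 : 2 < p) :
    ∏ χ ∈ Finset.univ.filter (fun χ : DirichletCharacter ℂ p => χ (-1) = -1),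
      DirichletCharacter.LFunction χ 1 =
    (Real.sqrt (π ^ (p - 1) *
          ((classNumber K : ℝ) / (classNumber (maximalRealSubfield K) : ℝ)) ^ 2 *
          2 ^ (p - 1) /
          (4 * (p : ℝ) ^ 2 * (p : ℝ) ^ (p - 2) / (p : ℝ) ^ ((p - 3) / 2))) : ℂ) := by
  have hres := residue_factor p K (by omega)
  have hpos := dedekindZeta_residue_pos (maximalRealSubfield K)
  have hposK := dedekindZeta_residue_pos K
  have hne : (dedekindZeta_residue (maximalRealSubfield K) : ℂ) ≠ 0 := by exact_mod_cast hpos.ne'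
  rw [mul_comm, ← div_eq_iff hne] at hres
  rw [← hres, ← Complex.ofReal_div]
  congr 1
  symm
  rw [Real.sqrt_eq_iff_mul_self_eq_of_pos (div_pos hposK hpos), ← sq]
  obtain ⟨m, hm⟩ : ∃ m, p = 2 * m + 3 := by
    have ho : p % 2 = 1 := Nat.odd_iff.mp ((Fact.out : p.Prime).odd_of_ne_two (by omega))
    exact ⟨(p - 3) / 2, by omega⟩
  have hFr := finrank_F p K
  have hKr := finrank_K p K
  have r1 : InfinitePlace.nrRealPlaces K = 0 := IsTotallyComplex.nrRealPlaces_eq_zero K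
  have r2 : InfinitePlace.nrComplexPlaces K = m + 1 := by
    have := IsTotallyComplex.finrank K; omega
  have r3 : InfinitePlace.nrComplexPlaces (maximalRealSubfield K) = 0 :=
    IsTotallyReal.nrComplexPlaces_eq_zero _
  have r4 : InfinitePlace.nrRealPlaces (maximalRealSubfield K) = m + 1 := by
    have := IsTotallyReal.finrank (maximalRealSubfield K); omega
  have t1 : Units.torsionOrder K = 2 * p := by
    rw [IsCyclotomicExtension.Rat.torsionOrder_eq (n := p) (K := K), if_neg]
    rw [Nat.not_even_iff_odd]; exact ⟨m + 1, by omega⟩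
  have t2 : Units.torsionOrder (maximalRealSubfield K) = 2 := torsion_real _
  have d1 : ((|discr K| : ℤ) : ℝ) = (p : ℝ) ^ (p - 2) := by
    rw [Int.abs_eq_natAbs, discr_K p K]; push_cast; rfl
  have d2 : ((|discr (maximalRealSubfield K)| : ℤ) : ℝ) = (p : ℝ) ^ ((p - 3) / 2) := by
    rw [Int.abs_eq_natAbs, discr_F p K hp2]; push_cast; rfl
  have rk : Units.rank K = m := by
    rw [Units.rank, InfinitePlace.card_eq_nrRealPlaces_add_nrComplexPlaces, r1, r2]; omega
  have hreg := IsCMField.regulator_div_regulator_eq_two_pow_mul_indexRealUnits_inv K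
  rw [index_one p K hp2, rk] at hreg
  have hRF := Units.regulator_pos (maximalRealSubfield K)
  rw [div_eq_iff hRF.ne'] at hreg
  have hhF : (0 : ℝ) < classNumber (maximalRealSubfield K) := Nat.cast_pos.mpr (classNumber_pos _)
  have hp0 : (0 : ℝ) < p := by exact_mod_cast (Fact.out : p.Prime).pos
  rw [dedekindZeta_residue_def, dedekindZeta_residue_def, r1, r2, r3, r4, t1, t2, hreg]
  rw [← Int.cast_abs, ← Int.cast_abs, d1, d2]
  have e1 : p - 1 = 2 * m + 2 := by omega
  have e2 : p - 2 = 2 * m + 1 := by omega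
  have e3 : (p - 3) / 2 = m := by omega
  rw [e1, e2, e3]
  have s1 : Real.sqrt ((p : ℝ) ^ (2 * m + 1)) ^ 2 = (p : ℝ) ^ (2 * m + 1) := Real.sq_sqrt (by positivity)
  have s2 : Real.sqrt ((p : ℝ) ^ m) ^ 2 = (p : ℝ) ^ m := Real.sq_sqrt (by positivity)
  have s1p : 0 < Real.sqrt ((p : ℝ) ^ (2 * m + 1)) := Real.sqrt_pos.mpr (by positivity)
  have s2p : 0 < Real.sqrt ((p : ℝ) ^ m) := Real.sqrt_pos.mpr (by positivity)
  simp only [div_pow, mul_pow, s1, s2]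
  push_cast
  field_simp
  ring
end Stmt16


namespace Stmt16
open Filter Topology NumberField

theorem classNumber_congr (K L : Type*) [Field K] [NumberField K] [Field L] [NumberField L]
    (e : K ≃+* L) : classNumber K = classNumber L :=
  Fintype.card_congr (ClassGroup.mulEquiv (RingOfIntegers.mapRingEquiv e)).toEquiv

open NumberField.IsCMField Polynomial in
theorem adjoin_real (p : ℕ) [Fact p.Prime] (K : Type*) [Field K] [NumberField K]
    [IsCyclotomicExtension {p} ℚ K] [IsCMField K] {ζ : K} (hζ : IsPrimitiveRoot ζ p) :
    (IntermediateField.adjoin ℚ {ζ + ζ⁻¹}).toSubfield = maximalRealSubfield K := by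
  set E : IntermediateField ℚ K := IntermediateField.adjoin ℚ {ζ + ζ⁻¹} with hE
  let M : IntermediateField ℚ K := (maximalRealSubfield K).toIntermediateField
    (fun x => by
      rw [eq_ratCast]
      exact SubfieldClass.ratCast_mem _ x)
  have hM : M.toSubfield = maximalRealSubfield K := rfl
  have hz0 : ζ ≠ 0 := hζ.ne_zero (NeZero.ne p)
  have hconj : complexConj K ζ = ζ⁻¹ := by
    have := congrArg (algebraMap (𝓞 K) K) (conj_zeta K hζ)
    apply eq_inv_of_mul_eq_one_left
    rw [map_mul, map_one] at this
    exact this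
  have hle : E ≤ M := by
    rw [hE, IntermediateField.adjoin_simple_le_iff]
    change ζ + ζ⁻¹ ∈ maximalRealSubfield K
    rw [← complexConj_eq_self_iff, map_add, map_inv₀, hconj, inv_inv, add_comm]
  have hEtop : IntermediateField.adjoin E {ζ} = ⊤ := by
    have h1 := adjoin_top_tower ℚ E K
      (IsCyclotomicExtension.adjoin_primitive_root_eq_top (A := ℚ) hζ)
    rw [eq_top_iff]
    intro x _
    have hx : x ∈ Algebra.adjoin E {ζ} := by rw [h1]; exact Algebra.mem_top
    exact IntermediateField.algebra_adjoin_le_adjoin _ _ hx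
  let a : E := ⟨ζ + ζ⁻¹, IntermediateField.mem_adjoin_simple_self ℚ _⟩
  have hfin : Module.finrank E K ≤ 2 := by
    have hIntg : IsIntegral E ζ := Algebra.IsIntegral.isIntegral ζ
    have h2 := IntermediateField.adjoin.finrank hIntg
    rw [hEtop, IntermediateField.finrank_top'] at h2
    rw [h2]
    have hdeg : (X ^ 2 - C a * X + 1 : E[X]).natDegree = 2 := by
      compute_degree!
    rw [← hdeg]
    refine natDegree_le_of_dvd (minpoly.dvd _ _ ?_) ?_
    · simp only [map_add, map_sub, map_mul, map_pow, aeval_X, aeval_C, map_one]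
      change ζ ^ 2 - (ζ + ζ⁻¹) * ζ + 1 = 0
      field_simp
      ring
    · intro h; rw [h] at hdeg; simp at hdeg
  have hMf : Module.finrank M K = 2 :=
    Algebra.IsQuadraticExtension.finrank_eq_two (maximalRealSubfield K) K
  have : E = M := IntermediateField.eq_of_le_of_finrank_le' hle (by rw [hMf]; exact hfin)
  rw [this, hM]

end Stmt16

theorem stmt16 (p : ℕ) [NeZero p] (hp : p.Prime) (hodd : Odd p)
    (Kp Kplus : IntermediateField ℚ ℂ)
    (hKp : Kp = IntermediateField.adjoin ℚ {Complex.exp (2 * π * Complex.I / p)})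
    (hKplus : Kplus = IntermediateField.adjoin ℚ
      {Complex.exp (2 * π * Complex.I / p) + (Complex.exp (2 * π * Complex.I / p))⁻¹})
    [NumberField Kp] [NumberField Kplus] :
    ∏ χ ∈ Finset.univ.filter (fun χ : DirichletCharacter ℂ p => χ (-1) = -1),
        DirichletCharacter.LFunction χ 1 =
      (Real.sqrt (π ^ (p - 1) *
          ((NumberField.classNumber Kp : ℝ) / (NumberField.classNumber Kplus : ℝ)) ^ 2 *
          2 ^ (p - 1) /
          (4 * (p : ℝ) ^ 2 * (p : ℝ) ^ (p - 2) / (p : ℝ) ^ ((p - 3) / 2))) : ℂ) := by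
  have hfact : Fact p.Prime := ⟨hp⟩
  have hp2 : 2 < p := lt_of_le_of_ne hp.two_le (fun h => by subst h; exact absurd hodd (by decide))
  have hroot : IsPrimitiveRoot (Complex.exp (2 * π * Complex.I / p)) p :=
    Complex.isPrimitiveRoot_exp p (NeZero.ne p)
  have hcyc : IsCyclotomicExtension {p} ℚ Kp := by
    have hIntg : IsAlgebraic ℚ (Complex.exp (2 * π * Complex.I / p)) :=
      (hroot.isIntegral hp.pos).tower_top.isAlgebraic
    rw [hKp]
    change IsCyclotomicExtension {p} ℚ (IntermediateField.adjoin ℚ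
      {Complex.exp (2 * π * Complex.I / p)}).toSubalgebra
    rw [IntermediateField.adjoin_simple_toSubalgebra_of_isAlgebraic hIntg]
    exact hroot.adjoin_isCyclotomicExtension ℚ
  have hcm : NumberField.IsCMField Kp := IsCyclotomicExtension.Rat.isCMField Kp (S := {p}) ⟨p, rfl, hp2⟩
  have hmem : Complex.exp (2 * π * Complex.I / p) ∈ Kp := by
    rw [hKp]; exact IntermediateField.mem_adjoin_simple_self ℚ _
  let ζ : Kp := ⟨_, hmem⟩
  have hζ : IsPrimitiveRoot ζ p :=
    IsPrimitiveRoot.of_map_of_injective (f := Kp.val) hroot Kp.val.injective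
  have hE := Stmt16.adjoin_real p Kp hζ
  have hlift : IntermediateField.lift (IntermediateField.adjoin ℚ {ζ + ζ⁻¹}) = Kplus := by
    rw [IntermediateField.lift_adjoin_simple, hKplus]
    rfl
  have e1 : IntermediateField.adjoin ℚ {ζ + ζ⁻¹} ≃+* Kplus :=
    ((IntermediateField.liftAlgEquiv _).trans (IntermediateField.equivOfEq hlift)).toRingEquiv
  have e2 : IntermediateField.adjoin ℚ {ζ + ζ⁻¹} ≃+* NumberField.maximalRealSubfield Kp :=
    RingEquiv.subfieldCongr hE
  rw [Stmt16.classNumber_congr Kplus (NumberField.maximalRealSubfield Kp) (e1.symm.trans e2)]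
  exact Stmt16.L_prod p Kp hp2
end
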